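/- arXiv:1912.01655 — 4 statements merged into one kernel-verified Lean document; each statement's English description precedes it below -/
import Mathlib

section
/- Let F and F' be polarized rigid graphing functions (analytic near the origin of ℂ², holomorphic in each variable, satisfying the reality condition). Let f, g be holomorphic near 0 ∈ ℂ, a ∈ ℝ\{0}, and assume F'(f(z), f̄(w)) = a·F(z,w) + (1/2)g(z) + (1/2)ḡ(w) for all (z,w) near (0,0). Then, identically near (0,0): F_{zzww}(z,w)·F_{zw}(z,w) − F_{zzw}(z,w)·F_{zww}(z,w) = (1/a²)·(f'(z)·f̄'(w))³·[F'_{zzww}·F'_{zw} − F'_{zzw}·F'_{zww}] evaluated at (f(z), f̄(w)), where f̄'(w) = conj(f'(conj w)). -/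
open Complex Filter Topology ComplexConjugate

/-- Partial derivative in the first (`z`) slot. -/
noncomputable def pd1 (F : ℂ → ℂ → ℂ) : ℂ → ℂ → ℂ := fun z w => deriv (fun t => F t w) z

/-- Partial derivative in the second (`w`) slot. -/
noncomputable def pd2 (F : ℂ → ℂ → ℂ) : ℂ → ℂ → ℂ := fun z w => deriv (fun t => F z t) w

/-- Polarized rigid graphing function: analytic near the origin of `ℂ²` (hence holomorphic
in each of the two variables), and satisfying the reality condition near the origin. -/
def IsPolarizedRigid (F : ℂ → ℂ → ℂ) : Prop :=
  AnalyticAt ℂ (fun p : ℂ × ℂ => F p.1 p.2) 0 ∧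
    ∀ᶠ p : ℂ × ℂ in 𝓝 0, F p.1 p.2 = conj (F (conj p.2) (conj p.1))


lemma hasDerivAt_sub_mul {k : ℂ → ℂ} {z₀ : ℂ} (hk : DifferentiableAt ℂ k z₀) :
    HasDerivAt (fun z => (z - z₀) * k z) (k z₀) z₀ := by
  have h := ((hasDerivAt_id z₀).sub_const z₀).fun_mul hk.hasDerivAt
  simpa only [id_eq, sub_self, zero_mul, add_zero, one_mul] using h

/-- A holomorphic function that is injective near a point has nonzero derivative there. -/
lemma deriv_ne_zero_of_injOn_nhds {f : ℂ → ℂ} {z₀ : ℂ} (hf : AnalyticAt ℂ f z₀) {s : Set ℂ}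
    (hs : s ∈ 𝓝 z₀) (hinj : Set.InjOn f s) : deriv f z₀ ≠ 0 := by
  intro hd
  have hfa : AnalyticAt ℂ (fun z => f z - f z₀) z₀ := hf.sub analyticAt_const
  have htop : analyticOrderAt (fun z => f z - f z₀) z₀ ≠ ⊤ := by
    intro h
    rw [analyticOrderAt_eq_top] at h
    have h2 : ∀ᶠ z in 𝓝[≠] z₀, f z - f z₀ = 0 ∧ z ∈ s ∧ z ≠ z₀ :=
      (h.filter_mono nhdsWithin_le_nhds).and
        (Filter.Eventually.and (nhdsWithin_le_nhds hs) self_mem_nhdsWithin)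
    obtain ⟨z, hz, hzs, hne⟩ := h2.exists
    exact hne (hinj hzs (mem_of_mem_nhds hs) (sub_eq_zero.mp hz))
  obtain ⟨n, hn⟩ := ENat.ne_top_iff_exists.mp htop
  obtain ⟨k, hk, hk0, hfk⟩ := hfa.analyticOrderAt_eq_natCast.mp hn.symm
  simp only [smul_eq_mul] at hfk
  have hn0 : n ≠ 0 := by
    rintro rfl
    have := hfk.self_of_nhds
    simp at this
    exact hk0 this.symm
  have hn1 : n ≠ 1 := by
    rintro rfl
    have h1 : deriv (fun z => f z - f z₀) z₀ = deriv (fun z => (z - z₀) ^ 1 * k z) z₀ :=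
      EventuallyEq.deriv_eq hfk
    have h2 : HasDerivAt (fun z => (z - z₀) ^ 1 * k z) (k z₀) z₀ := by
      simpa using hasDerivAt_sub_mul hk.differentiableAt
    rw [h2.deriv, deriv_sub_const, hd] at h1
    exact hk0 h1.symm
  have hn2 : 1 < n := by omega
  let r : ℂ → ℂ := fun z => k z₀ ^ ((n : ℂ)⁻¹) * (k z / k z₀) ^ ((n : ℂ)⁻¹)
  have hr : AnalyticAt ℂ r z₀ := by
    refine analyticAt_const.mul (AnalyticAt.cpow (hk.div_const) analyticAt_const ?_)
    rw [div_self hk0]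
    exact one_mem_slitPlane
  have hrpow : ∀ z, r z ^ n = k z := by
    intro z
    simp only [r, mul_pow, cpow_nat_inv_pow _ hn0]
    field_simp
  have hr0 : r z₀ ≠ 0 := by
    intro h
    apply hk0
    rw [← hrpow, h, zero_pow hn0]
  let u : ℂ → ℂ := fun z => (z - z₀) * r z
  have hu : AnalyticAt ℂ u z₀ := (analyticAt_id.sub analyticAt_const).mul hr
  have hud : deriv u z₀ = r z₀ := (hasDerivAt_sub_mul hr.differentiableAt).deriv
  have hmap : map u (𝓝 z₀) = 𝓝 0 := by
    have := hu.hasStrictDerivAt.map_nhds_eq (by rw [hud]; exact hr0)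
    simpa [u] using this
  have himg : u '' (s ∩ {z | f z - f z₀ = (z - z₀) ^ n * k z}) ∈ 𝓝 (0 : ℂ) := by
    rw [← hmap]
    exact image_mem_map (inter_mem hs hfk)
  have hprim := Complex.isPrimitiveRoot_exp n hn0
  set ζ := Complex.exp (2 * Real.pi * I / n)
  have hrot : ∀ᶠ t in 𝓝 (0 : ℂ),
      ζ * t ∈ u '' (s ∩ {z | f z - f z₀ = (z - z₀) ^ n * k z}) := by
    have hc : Tendsto (fun t : ℂ => ζ * t) (𝓝 0) (𝓝 0) := by
      have : Continuous (fun t : ℂ => ζ * t) := by fun_prop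
      simpa using this.tendsto 0
    exact hc himg
  have hboth : ∀ᶠ t in 𝓝[≠] (0 : ℂ),
      (t ∈ u '' (s ∩ {z | f z - f z₀ = (z - z₀) ^ n * k z}) ∧
        ζ * t ∈ u '' (s ∩ {z | f z - f z₀ = (z - z₀) ^ n * k z})) ∧ t ≠ 0 :=
    ((Filter.Eventually.and himg hrot).filter_mono nhdsWithin_le_nhds).and self_mem_nhdsWithin
  obtain ⟨t, ⟨⟨z₁, ⟨hz₁, hf₁⟩, hu₁⟩, ⟨z₂, ⟨hz₂, hf₂⟩, hu₂⟩⟩, ht⟩ := hboth.exists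
  have e₁ : f z₁ - f z₀ = t ^ n := by
    rw [← hu₁, mul_pow, hrpow]; exact hf₁
  have e₂ : f z₂ - f z₀ = t ^ n := by
    have : f z₂ - f z₀ = (ζ * t) ^ n := by
      rw [← hu₂, mul_pow, hrpow]; exact hf₂
    rw [this, mul_pow, hprim.pow_eq_one, one_mul]
  have heq : z₁ = z₂ := hinj hz₁ hz₂ (by linear_combination e₁ - e₂)
  rw [← heq, hu₁] at hu₂
  have : ζ = 1 := by
    have h : (ζ - 1) * t = 0 := by linear_combination -hu₂
    simpa [ht, sub_eq_zero] using h
  exact hprim.ne_one hn2 this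

/-- A holomorphic function factoring set-theoretically through `f` near a critical point of `f` is
critical there as well. -/
lemma deriv_eq_zero_of_factors {f γ : ℂ → ℂ} {z₀ : ℂ} (hf : AnalyticAt ℂ f z₀)
    (hγ : AnalyticAt ℂ γ z₀) (hd : deriv f z₀ = 0) {s : Set ℂ} (hs : s ∈ 𝓝 z₀)
    (hfac : ∀ z ∈ s, ∀ z' ∈ s, f z = f z' → γ z = γ z') : deriv γ z₀ = 0 := by
  by_contra hne
  have hleft := hγ.hasStrictDerivAt.eventually_left_inverse hne
  refine deriv_ne_zero_of_injOn_nhds hf (inter_mem hs hleft) ?_ hd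
  rintro z ⟨hz, hz'⟩ y ⟨hy, hy'⟩ h
  have := hfac z hz y hy h
  rw [Set.mem_ofPred_eq] at hz' hy'
  rw [← hz', ← hy', this]

lemma AnalyticAt.conj_comp_conj {f : ℂ → ℂ} {w : ℂ} (hf : AnalyticAt ℂ f (conj w)) :
    AnalyticAt ℂ (fun t => conj (f (conj t))) w := by
  rw [analyticAt_iff_eventually_differentiableAt] at hf ⊢
  filter_upwards [(continuous_conj.tendsto w).eventually hf] with t ht
  exact differentiableAt_conj_conj_iff.mpr ht

lemma deriv_conj_comp_conj (f : ℂ → ℂ) (w : ℂ) :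
    deriv (fun t => conj (f (conj t))) w = conj (deriv f (conj w)) :=
  congrFun (deriv_conj_conj (f := f)) w

lemma Filter.Eventually.nhds_fst {P : ℂ × ℂ → Prop} {q : ℂ × ℂ} (h : ∀ᶠ p in 𝓝 q, P p) :
    ∀ᶠ t in 𝓝 q.1, P (t, q.2) :=
  (Continuous.prodMk_left q.2).continuousAt.eventually (p := P) h

lemma Filter.Eventually.nhds_snd {P : ℂ × ℂ → Prop} {q : ℂ × ℂ} (h : ∀ᶠ p in 𝓝 q, P p) :
    ∀ᶠ t in 𝓝 q.2, P (q.1, t) :=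
  (Continuous.prodMk_right q.1).continuousAt.eventually (p := P) h

lemma pd1_congr {A B : ℂ → ℂ → ℂ} {q : ℂ × ℂ} (h : ∀ᶠ p in 𝓝 q, A p.1 p.2 = B p.1 p.2) :
    ∀ᶠ p in 𝓝 q, pd1 A p.1 p.2 = pd1 B p.1 p.2 := by
  filter_upwards [h.eventually_nhds] with p hp
  exact EventuallyEq.deriv_eq hp.nhds_fst

lemma pd2_congr {A B : ℂ → ℂ → ℂ} {q : ℂ × ℂ} (h : ∀ᶠ p in 𝓝 q, A p.1 p.2 = B p.1 p.2) :
    ∀ᶠ p in 𝓝 q, pd2 A p.1 p.2 = pd2 B p.1 p.2 := by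
  filter_upwards [h.eventually_nhds] with p hp
  exact EventuallyEq.deriv_eq hp.nhds_snd

section Analytic

variable {A : ℂ → ℂ → ℂ} {q : ℂ × ℂ}

lemma differentiableAt_fst_slot (hA : AnalyticAt ℂ (fun p : ℂ × ℂ => A p.1 p.2) q) :
    DifferentiableAt ℂ (fun t => A t q.2) q.1 :=
  hA.curry_left.differentiableAt

lemma differentiableAt_snd_slot (hA : AnalyticAt ℂ (fun p : ℂ × ℂ => A p.1 p.2) q) :
    DifferentiableAt ℂ (fun t => A q.1 t) q.2 :=
  hA.curry_right.differentiableAt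

lemma pd1_eq_fderiv (hA : DifferentiableAt ℂ (fun p : ℂ × ℂ => A p.1 p.2) q) :
    pd1 A q.1 q.2 = fderiv ℂ (fun p : ℂ × ℂ => A p.1 p.2) q (1, 0) := by
  have h : HasDerivAt (fun t : ℂ => (t, q.2)) ((1 : ℂ), (0 : ℂ)) q.1 :=
    (hasDerivAt_id q.1).prodMk (hasDerivAt_const q.1 q.2)
  exact (hA.hasFDerivAt.comp_hasDerivAt q.1 h).deriv

lemma pd2_eq_fderiv (hA : DifferentiableAt ℂ (fun p : ℂ × ℂ => A p.1 p.2) q) :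
    pd2 A q.1 q.2 = fderiv ℂ (fun p : ℂ × ℂ => A p.1 p.2) q (0, 1) := by
  have h : HasDerivAt (fun t : ℂ => (q.1, t)) ((0 : ℂ), (1 : ℂ)) q.2 :=
    (hasDerivAt_const q.2 q.1).prodMk (hasDerivAt_id q.2)
  exact (hA.hasFDerivAt.comp_hasDerivAt q.2 h).deriv

lemma pd1_eventuallyEq_fderiv (hA : AnalyticAt ℂ (fun p : ℂ × ℂ => A p.1 p.2) q) :
    ∀ᶠ p in 𝓝 q, pd1 A p.1 p.2 = fderiv ℂ (fun p : ℂ × ℂ => A p.1 p.2) p (1, 0) := by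
  filter_upwards [hA.eventually_analyticAt] with p hp using pd1_eq_fderiv hp.differentiableAt

lemma pd2_eventuallyEq_fderiv (hA : AnalyticAt ℂ (fun p : ℂ × ℂ => A p.1 p.2) q) :
    ∀ᶠ p in 𝓝 q, pd2 A p.1 p.2 = fderiv ℂ (fun p : ℂ × ℂ => A p.1 p.2) p (0, 1) := by
  filter_upwards [hA.eventually_analyticAt] with p hp using pd2_eq_fderiv hp.differentiableAt

lemma AnalyticAt.pd1 (hA : AnalyticAt ℂ (fun p : ℂ × ℂ => A p.1 p.2) q) :
    AnalyticAt ℂ (fun p : ℂ × ℂ => pd1 A p.1 p.2) q :=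
  (((ContinuousLinearMap.apply ℂ ℂ ((1, 0) : ℂ × ℂ)).analyticAt _).fun_comp hA.fderiv).congr
    ((pd1_eventuallyEq_fderiv hA).mono fun _ h => h.symm)

lemma AnalyticAt.pd2 (hA : AnalyticAt ℂ (fun p : ℂ × ℂ => A p.1 p.2) q) :
    AnalyticAt ℂ (fun p : ℂ × ℂ => pd2 A p.1 p.2) q :=
  (((ContinuousLinearMap.apply ℂ ℂ ((0, 1) : ℂ × ℂ)).analyticAt _).fun_comp hA.fderiv).congr
    ((pd2_eventuallyEq_fderiv hA).mono fun _ h => h.symm)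

lemma pd1_pd2_comm (hA : AnalyticAt ℂ (fun p : ℂ × ℂ => A p.1 p.2) q) :
    pd1 (pd2 A) q.1 q.2 = pd2 (pd1 A) q.1 q.2 := by
  have key : ∀ v : ℂ × ℂ, fderiv ℂ (fun p => fderiv ℂ (fun p : ℂ × ℂ => A p.1 p.2) p v) q =
      (fderiv ℂ (fderiv ℂ (fun p : ℂ × ℂ => A p.1 p.2)) q).flip v := by
    intro v
    rw [fderiv_clm_apply hA.fderiv.differentiableAt (differentiableAt_const v)]
    simp
  rw [pd1_eq_fderiv hA.pd2.differentiableAt, pd2_eq_fderiv hA.pd1.differentiableAt,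
    EventuallyEq.fderiv_eq (pd1_eventuallyEq_fderiv hA),
    EventuallyEq.fderiv_eq (pd2_eventuallyEq_fderiv hA), key, key]
  exact hA.contDiffAt.isSymmSndFDerivAt_of_omega _ _

end Analytic

/-- The numerator `F_{zzww}F_{zw} − F_{zzw}F_{zww}` of the relative invariant. -/
noncomputable def rigidNumerator (F : ℂ → ℂ → ℂ) (z w : ℂ) : ℂ :=
  pd1 (pd1 (pd2 (pd2 F))) z w * pd1 (pd2 F) z w -
    pd1 (pd1 (pd2 F)) z w * pd1 (pd2 (pd2 F)) z w

section Substitution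

variable {G H : ℂ → ℂ → ℂ} {φ ψ : ℂ → ℂ} {q : ℂ × ℂ}

lemma pd1_substitution (hH : AnalyticAt ℂ (fun p : ℂ × ℂ => H p.1 p.2) (φ q.1, ψ q.2))
    (hφ : AnalyticAt ℂ φ q.1) :
    pd1 (fun z w => H (φ z) (ψ w)) q.1 q.2 = deriv φ q.1 * pd1 H (φ q.1) (ψ q.2) := by
  have h := (differentiableAt_fst_slot hH).hasDerivAt.comp q.1 hφ.differentiableAt.hasDerivAt
  rw [mul_comm]
  exact h.deriv

lemma pd2_substitution (hH : AnalyticAt ℂ (fun p : ℂ × ℂ => H p.1 p.2) (φ q.1, ψ q.2))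
    (hψ : AnalyticAt ℂ ψ q.2) :
    pd2 (fun z w => H (φ z) (ψ w)) q.1 q.2 = deriv ψ q.2 * pd2 H (φ q.1) (ψ q.2) := by
  have h := (differentiableAt_snd_slot hH).hasDerivAt.comp q.2 hψ.differentiableAt.hasDerivAt
  rw [mul_comm]
  exact h.deriv

lemma eventually_analyticAt_substitution
    (hH : AnalyticAt ℂ (fun p : ℂ × ℂ => H p.1 p.2) (φ q.1, ψ q.2))
    (hφ : AnalyticAt ℂ φ q.1) (hψ : AnalyticAt ℂ ψ q.2) :
    ∀ᶠ p in 𝓝 q, AnalyticAt ℂ (fun p : ℂ × ℂ => H p.1 p.2) (φ p.1, ψ p.2) ∧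
      AnalyticAt ℂ φ p.1 ∧ AnalyticAt ℂ ψ p.2 := by
  have hc : ContinuousAt (fun p : ℂ × ℂ => (φ p.1, ψ p.2)) q :=
    (ContinuousAt.comp (f := Prod.fst) hφ.continuousAt continuousAt_fst).prodMk
      (ContinuousAt.comp (f := Prod.snd) hψ.continuousAt continuousAt_snd)
  exact (hc.eventually hH.eventually_analyticAt).and
    ((continuousAt_fst.eventually hφ.eventually_analyticAt).and
      (continuousAt_snd.eventually hψ.eventually_analyticAt))

lemma pd1_mul_left (c : ℂ → ℂ) (A : ℂ → ℂ → ℂ) (z w : ℂ) :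
    pd1 (fun z w => c w * A z w) z w = c w * pd1 A z w :=
  deriv_const_mul_field (c w)

lemma pd1_substitution_mul (hH : AnalyticAt ℂ (fun p : ℂ × ℂ => H p.1 p.2) (φ q.1, ψ q.2))
    (hφ : AnalyticAt ℂ φ q.1) {c : ℂ → ℂ} (hc : AnalyticAt ℂ c q.1) :
    pd1 (fun z w => c z * H (φ z) (ψ w)) q.1 q.2 =
      deriv c q.1 * H (φ q.1) (ψ q.2) + c q.1 * (deriv φ q.1 * pd1 H (φ q.1) (ψ q.2)) := by
  have h := (differentiableAt_fst_slot hH).hasDerivAt.comp q.1 hφ.differentiableAt.hasDerivAt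
  rw [mul_comm (deriv φ q.1)]
  exact (hc.differentiableAt.hasDerivAt.mul h).deriv

lemma pd2_substitution_mul (hH : AnalyticAt ℂ (fun p : ℂ × ℂ => H p.1 p.2) (φ q.1, ψ q.2))
    (hψ : AnalyticAt ℂ ψ q.2) {c : ℂ → ℂ} (hc : AnalyticAt ℂ c q.2) :
    pd2 (fun z w => c w * H (φ z) (ψ w)) q.1 q.2 =
      deriv c q.2 * H (φ q.1) (ψ q.2) + c q.2 * (deriv ψ q.2 * pd2 H (φ q.1) (ψ q.2)) := by
  have h := (differentiableAt_snd_slot hH).hasDerivAt.comp q.2 hψ.differentiableAt.hasDerivAt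
  rw [mul_comm (deriv ψ q.2)]
  exact (hc.differentiableAt.hasDerivAt.mul h).deriv

/-- The numerator transforms by `(φ' ψ')³` under a substitution `(z, w) ↦ (φ z, ψ w)`, at points
where `H` is known to be analytic. -/
lemma rigidNumerator_substitution_of_analyticAt
    (hH : AnalyticAt ℂ (fun p : ℂ × ℂ => H p.1 p.2) (φ q.1, ψ q.2))
    (hφ : AnalyticAt ℂ φ q.1) (hψ : AnalyticAt ℂ ψ q.2)
    (h : ∀ᶠ p in 𝓝 q, G p.1 p.2 = H (φ p.1) (ψ p.2)) :
    rigidNumerator G q.1 q.2 =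
      (deriv φ q.1 * deriv ψ q.2) ^ 3 * rigidNumerator H (φ q.1) (ψ q.2) := by
  have hev := eventually_analyticAt_substitution hH hφ hψ
  have h2 : ∀ᶠ p in 𝓝 q, pd2 G p.1 p.2 = deriv ψ p.2 * pd2 H (φ p.1) (ψ p.2) := by
    filter_upwards [pd2_congr (B := fun z w => H (φ z) (ψ w)) h, hev] with p hp ⟨a, _, c⟩
    rw [hp, pd2_substitution a c]
  have h12 : ∀ᶠ p in 𝓝 q, pd1 (pd2 G) p.1 p.2 =
      deriv ψ p.2 * (deriv φ p.1 * pd1 (pd2 H) (φ p.1) (ψ p.2)) := by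
    filter_upwards [pd1_congr (B := fun z w => deriv ψ w * pd2 H (φ z) (ψ w)) h2, hev]
      with p hp ⟨a, b, _⟩
    rw [hp, pd1_mul_left (deriv ψ) (fun z w => pd2 H (φ z) (ψ w)), pd1_substitution a.pd2 b]
  have h112 : ∀ᶠ p in 𝓝 q, pd1 (pd1 (pd2 G)) p.1 p.2 =
      deriv ψ p.2 * (deriv (deriv φ) p.1 * pd1 (pd2 H) (φ p.1) (ψ p.2) +
        deriv φ p.1 * (deriv φ p.1 * pd1 (pd1 (pd2 H)) (φ p.1) (ψ p.2))) := by
    filter_upwards [pd1_congr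
      (B := fun z w => deriv ψ w * (deriv φ z * pd1 (pd2 H) (φ z) (ψ w))) h12, hev]
      with p hp ⟨a, b, _⟩
    rw [hp, pd1_mul_left (deriv ψ) (fun z w => deriv φ z * pd1 (pd2 H) (φ z) (ψ w)),
      pd1_substitution_mul a.pd2.pd1 b b.deriv]
  have h22 : ∀ᶠ p in 𝓝 q, pd2 (pd2 G) p.1 p.2 =
      deriv (deriv ψ) p.2 * pd2 H (φ p.1) (ψ p.2) +
        deriv ψ p.2 * (deriv ψ p.2 * pd2 (pd2 H) (φ p.1) (ψ p.2)) := by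
    filter_upwards [pd2_congr (B := fun z w => deriv ψ w * pd2 H (φ z) (ψ w)) h2, hev]
      with p hp ⟨a, _, c⟩
    rw [hp, pd2_substitution_mul a.pd2 c c.deriv]
  have h122 : ∀ᶠ p in 𝓝 q, pd1 (pd2 (pd2 G)) p.1 p.2 =
      deriv φ p.1 * (deriv (deriv ψ) p.2 * pd1 (pd2 H) (φ p.1) (ψ p.2) +
        deriv ψ p.2 ^ 2 * pd1 (pd2 (pd2 H)) (φ p.1) (ψ p.2)) := by
    filter_upwards [pd1_congr (B := fun z w => deriv (deriv ψ) w * pd2 H (φ z) (ψ w) +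
        deriv ψ w * (deriv ψ w * pd2 (pd2 H) (φ z) (ψ w))) h22, hev]
      with p hp ⟨a, b, _⟩
    have d1 := (differentiableAt_fst_slot a.pd2).hasDerivAt.comp p.1
      b.differentiableAt.hasDerivAt
    have d2 := (differentiableAt_fst_slot a.pd2.pd2).hasDerivAt.comp p.1
      b.differentiableAt.hasDerivAt
    have d := ((d1.const_mul (deriv (deriv ψ) p.2)).add
      ((d2.const_mul (deriv ψ p.2)).const_mul (deriv ψ p.2))).deriv
    refine hp.trans (d.trans ?_)
    simp only [pd1]
    ring
  have h1122 : pd1 (pd1 (pd2 (pd2 G))) q.1 q.2 =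
      deriv (deriv φ) q.1 * (deriv (deriv ψ) q.2 * pd1 (pd2 H) (φ q.1) (ψ q.2) +
        deriv ψ q.2 ^ 2 * pd1 (pd2 (pd2 H)) (φ q.1) (ψ q.2)) +
      deriv φ q.1 ^ 2 * (deriv (deriv ψ) q.2 * pd1 (pd1 (pd2 H)) (φ q.1) (ψ q.2) +
        deriv ψ q.2 ^ 2 * pd1 (pd1 (pd2 (pd2 H))) (φ q.1) (ψ q.2)) := by
    have hp := (pd1_congr (B := fun z w => deriv φ z *
      (deriv (deriv ψ) w * pd1 (pd2 H) (φ z) (ψ w) +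
        deriv ψ w ^ 2 * pd1 (pd2 (pd2 H)) (φ z) (ψ w))) h122).self_of_nhds
    have d1 := (differentiableAt_fst_slot hH.pd2.pd1).hasDerivAt.comp q.1
      hφ.differentiableAt.hasDerivAt
    have d2 := (differentiableAt_fst_slot hH.pd2.pd2.pd1).hasDerivAt.comp q.1
      hφ.differentiableAt.hasDerivAt
    have d := (hφ.deriv.differentiableAt.hasDerivAt.mul
      ((d1.const_mul (deriv (deriv ψ) q.2)).add (d2.const_mul (deriv ψ q.2 ^ 2)))).deriv
    refine hp.trans (d.trans ?_)
    simp only [pd1, Pi.add_apply, Function.comp_apply]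
    ring
  simp only [rigidNumerator, h1122, h12.self_of_nhds, h112.self_of_nhds, h122.self_of_nhds]
  ring

/-- Analyticity descends along a substitution with nonvanishing derivatives. -/
lemma analyticAt_of_substitution
    (hG : AnalyticAt ℂ (fun p : ℂ × ℂ => G p.1 p.2) q)
    (hφ : AnalyticAt ℂ φ q.1) (hψ : AnalyticAt ℂ ψ q.2)
    (hφ0 : deriv φ q.1 ≠ 0) (hψ0 : deriv ψ q.2 ≠ 0)
    (h : ∀ᶠ p in 𝓝 q, G p.1 p.2 = H (φ p.1) (ψ p.2)) :
    AnalyticAt ℂ (fun p : ℂ × ℂ => H p.1 p.2) (φ q.1, ψ q.2) := by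
  let r := hφ.hasStrictDerivAt.localInverse _ _ _ hφ0
  let s := hψ.hasStrictDerivAt.localInverse _ _ _ hψ0
  have hr : AnalyticAt ℂ r (φ q.1) := hφ.analyticAt_localInverse hφ0
  have hs : AnalyticAt ℂ s (ψ q.2) := hψ.analyticAt_localInverse hψ0
  have hr0 : r (φ q.1) = q.1 := HasStrictFDerivAt.localInverse_apply_image ..
  have hs0 : s (ψ q.2) = q.2 := HasStrictFDerivAt.localInverse_apply_image ..
  have hinv : AnalyticAt ℂ (fun p : ℂ × ℂ => (r p.1, s p.2)) (φ q.1, ψ q.2) :=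
    (AnalyticAt.fun_comp (f := Prod.fst) hr analyticAt_fst).prod
      (AnalyticAt.fun_comp (f := Prod.snd) hs analyticAt_snd)
  have hq : (r (φ q.1), s (ψ q.2)) = q := by rw [hr0, hs0]
  have hG' : AnalyticAt ℂ (fun p : ℂ × ℂ => G (r p.1) (s p.2)) (φ q.1, ψ q.2) :=
    AnalyticAt.fun_comp (g := fun p : ℂ × ℂ => G p.1 p.2) (by rw [hq]; exact hG) hinv
  refine hG'.congr ?_
  have e1 : ∀ᶠ p : ℂ × ℂ in 𝓝 (φ q.1, ψ q.2), φ (r p.1) = p.1 :=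
    (continuousAt_fst (p := (φ q.1, ψ q.2))).eventually
      (hφ.hasStrictDerivAt.eventually_right_inverse hφ0)
  have e2 : ∀ᶠ p : ℂ × ℂ in 𝓝 (φ q.1, ψ q.2), ψ (s p.2) = p.2 :=
    (continuousAt_snd (p := (φ q.1, ψ q.2))).eventually
      (hψ.hasStrictDerivAt.eventually_right_inverse hψ0)
  have e3 : ∀ᶠ p : ℂ × ℂ in 𝓝 (φ q.1, ψ q.2), G (r p.1) (s p.2) = H (φ (r p.1)) (ψ (s p.2)) := by
    have ht := hinv.continuousAt.tendsto
    rw [hq] at ht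
    exact ht.eventually h
  filter_upwards [e1, e2, e3] with p h1 h2 h3
  rw [h3, h1, h2]

lemma pd1_eventually_eq_zero
    (hG : AnalyticAt ℂ (fun p : ℂ × ℂ => G p.1 p.2) q)
    (hφ : AnalyticAt ℂ φ q.1) (hφ0 : deriv φ q.1 = 0)
    (h : ∀ᶠ p in 𝓝 q, G p.1 p.2 = H (φ p.1) (ψ p.2)) :
    ∀ᶠ w in 𝓝 q.2, pd1 G q.1 w = 0 := by
  filter_upwards [h.eventually_nhds.nhds_snd, hG.eventually_analyticAt.nhds_snd] with w hw hGw
  refine deriv_eq_zero_of_factors hφ hGw.curry_left hφ0 hw.nhds_fst ?_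
  intro z hz z' hz' e
  change G z w = H (φ z) (ψ w) at hz
  change G z' w = H (φ z') (ψ w) at hz'
  rw [hz, hz', e]

lemma pd2_eventually_eq_zero
    (hG : AnalyticAt ℂ (fun p : ℂ × ℂ => G p.1 p.2) q)
    (hψ : AnalyticAt ℂ ψ q.2) (hψ0 : deriv ψ q.2 = 0)
    (h : ∀ᶠ p in 𝓝 q, G p.1 p.2 = H (φ p.1) (ψ p.2)) :
    ∀ᶠ z in 𝓝 q.1, pd2 G z q.2 = 0 := by
  filter_upwards [h.eventually_nhds.nhds_fst, hG.eventually_analyticAt.nhds_fst] with z hz hGz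
  refine deriv_eq_zero_of_factors hψ hGz.curry_right hψ0 hz.nhds_snd ?_
  intro w hw w' hw' e
  change G z w = H (φ z) (ψ w) at hw
  change G z w' = H (φ z) (ψ w') at hw'
  rw [hw, hw', e]

lemma rigidNumerator_eq_zero_of_pd1
    (hG : AnalyticAt ℂ (fun p : ℂ × ℂ => G p.1 p.2) q)
    (h : ∀ᶠ w in 𝓝 q.2, pd1 G q.1 w = 0) : rigidNumerator G q.1 q.2 = 0 := by
  have h12 : ∀ᶠ w in 𝓝 q.2, pd1 (pd2 G) q.1 w = 0 := by
    filter_upwards [h.eventually_nhds, hG.eventually_analyticAt.nhds_snd] with w hw hGw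
    refine (pd1_pd2_comm hGw).trans ?_
    exact (EventuallyEq.deriv_eq hw).trans (deriv_const _ _)
  have h122 : pd1 (pd2 (pd2 G)) q.1 q.2 = 0 := by
    refine (pd1_pd2_comm hG.pd2).trans ?_
    exact (EventuallyEq.deriv_eq h12).trans (deriv_const _ _)
  simp [rigidNumerator, h12.self_of_nhds, h122]

lemma rigidNumerator_eq_zero_of_pd2
    (h : ∀ᶠ z in 𝓝 q.1, pd2 G z q.2 = 0) : rigidNumerator G q.1 q.2 = 0 := by
  have h12 : ∀ᶠ z in 𝓝 q.1, pd1 (pd2 G) z q.2 = 0 := by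
    filter_upwards [h.eventually_nhds] with z hz
    exact (EventuallyEq.deriv_eq hz).trans (deriv_const _ _)
  have h112 : pd1 (pd1 (pd2 G)) q.1 q.2 = 0 :=
    (EventuallyEq.deriv_eq h12).trans (deriv_const _ _)
  simp [rigidNumerator, h12.self_of_nhds, h112]

/-- The transformation rule for the numerator; analyticity of `H` at the image point is not
needed. -/
lemma rigidNumerator_substitution
    (hG : AnalyticAt ℂ (fun p : ℂ × ℂ => G p.1 p.2) q)
    (hφ : AnalyticAt ℂ φ q.1) (hψ : AnalyticAt ℂ ψ q.2)
    (h : ∀ᶠ p in 𝓝 q, G p.1 p.2 = H (φ p.1) (ψ p.2)) :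
    rigidNumerator G q.1 q.2 =
      (deriv φ q.1 * deriv ψ q.2) ^ 3 * rigidNumerator H (φ q.1) (ψ q.2) := by
  by_cases hφ0 : deriv φ q.1 = 0
  · rw [rigidNumerator_eq_zero_of_pd1 hG (pd1_eventually_eq_zero hG hφ hφ0 h), hφ0]
    ring
  by_cases hψ0 : deriv ψ q.2 = 0
  · rw [rigidNumerator_eq_zero_of_pd2 (pd2_eventually_eq_zero hG hψ hψ0 h), hψ0]
    ring
  exact rigidNumerator_substitution_of_analyticAt
    (analyticAt_of_substitution hG hφ hψ hφ0 hψ0 h) hφ hψ h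

end Substitution

lemma pd1_const_mul (c : ℂ) (A : ℂ → ℂ → ℂ) : pd1 (fun z w => c * A z w) =
    fun z w => c * pd1 A z w := by
  ext z w
  exact deriv_const_mul_field c

/-- Scaling by `c` and adding pluriharmonic terms multiplies the numerator by `c²`. -/
lemma rigidNumerator_affine {F : ℂ → ℂ → ℂ} {q : ℂ × ℂ} (c : ℂ) {α β : ℂ → ℂ}
    (hF : AnalyticAt ℂ (fun p : ℂ × ℂ => F p.1 p.2) q) (hβ : AnalyticAt ℂ β q.2) :
    rigidNumerator (fun z w => c * F z w + α z + β w) q.1 q.2 =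
      c ^ 2 * rigidNumerator F q.1 q.2 := by
  set G : ℂ → ℂ → ℂ := fun z w => c * F z w + α z + β w
  have h2 : ∀ᶠ p in 𝓝 q, pd2 G p.1 p.2 = c * pd2 F p.1 p.2 + deriv β p.2 := by
    filter_upwards [hF.eventually_analyticAt,
      continuousAt_snd.eventually hβ.eventually_analyticAt] with p hp hβp
    exact ((((differentiableAt_snd_slot hp).hasDerivAt.const_mul c).add_const (α p.1)).add
      hβp.differentiableAt.hasDerivAt).deriv
  have h22 : ∀ᶠ p in 𝓝 q, pd2 (pd2 G) p.1 p.2 =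
      c * pd2 (pd2 F) p.1 p.2 + deriv (deriv β) p.2 := by
    filter_upwards [pd2_congr (B := fun z w => c * pd2 F z w + deriv β w) h2,
      hF.eventually_analyticAt,
      continuousAt_snd.eventually hβ.eventually_analyticAt] with p h hp hβp
    exact h.trans (((differentiableAt_snd_slot hp.pd2).hasDerivAt.const_mul c).add
      hβp.deriv.differentiableAt.hasDerivAt).deriv
  have pd1_drop : ∀ (A : ℂ → ℂ → ℂ) (b : ℂ → ℂ) (z w : ℂ),
      pd1 (fun z w => c * A z w + b w) z w = c * pd1 A z w := by
    intro A b z w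
    exact (deriv_add_const _).trans (deriv_const_mul_field c)
  have h12 : ∀ᶠ p in 𝓝 q, pd1 (pd2 G) p.1 p.2 = c * pd1 (pd2 F) p.1 p.2 := by
    filter_upwards [pd1_congr (B := fun z w => c * pd2 F z w + deriv β w) h2] with p h
    rw [h, pd1_drop]
  have h122 : ∀ᶠ p in 𝓝 q, pd1 (pd2 (pd2 G)) p.1 p.2 = c * pd1 (pd2 (pd2 F)) p.1 p.2 := by
    filter_upwards [pd1_congr (B := fun z w => c * pd2 (pd2 F) z w + deriv (deriv β) w) h22]
      with p h
    rw [h, pd1_drop]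
  have h112 := (pd1_congr (B := fun z w => c * pd1 (pd2 F) z w) h12).self_of_nhds
  have h1122 := (pd1_congr (B := fun z w => c * pd1 (pd2 (pd2 F)) z w) h122).self_of_nhds
  rw [pd1_const_mul] at h112 h1122
  simp only [rigidNumerator, h112, h1122, h12.self_of_nhds, h122.self_of_nhds]
  ring

/-- transformation rule, through a rigid biholomorphic correspondence, of the
numerator `F_{zzww}F_{zw} − F_{zzw}F_{zww}` of the relative invariant `R`. -/
theorem stmt2
    (F F' : ℂ → ℂ → ℂ) (hF : IsPolarizedRigid F) (hF' : IsPolarizedRigid F')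
    (f g : ℂ → ℂ) (hf : AnalyticAt ℂ f 0) (hg : AnalyticAt ℂ g 0)
    (a : ℝ) (ha : a ≠ 0)
    (hfund : ∀ᶠ p : ℂ × ℂ in 𝓝 0,
      F' (f p.1) (conj (f (conj p.2))) =
        (a : ℂ) * F p.1 p.2 + (1 / 2) * g p.1 + (1 / 2) * conj (g (conj p.2))) :
    ∀ᶠ p : ℂ × ℂ in 𝓝 0,
      pd1 (pd1 (pd2 (pd2 F))) p.1 p.2 * pd1 (pd2 F) p.1 p.2 -
          pd1 (pd1 (pd2 F)) p.1 p.2 * pd1 (pd2 (pd2 F)) p.1 p.2 =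
        ((a : ℂ) ^ 2)⁻¹ * (deriv f p.1 * conj (deriv f (conj p.2))) ^ 3 *
          (pd1 (pd1 (pd2 (pd2 F'))) (f p.1) (conj (f (conj p.2))) *
              pd1 (pd2 F') (f p.1) (conj (f (conj p.2))) -
            pd1 (pd1 (pd2 F')) (f p.1) (conj (f (conj p.2))) *
              pd1 (pd2 (pd2 F')) (f p.1) (conj (f (conj p.2)))) := by
  have hconj : ContinuousAt (fun p : ℂ × ℂ => conj p.2) 0 :=
    (continuous_conj.comp continuous_snd).continuousAt
  have hfst : ContinuousAt (fun p : ℂ × ℂ => p.1) 0 := continuousAt_fst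
  have hf2 : ∀ᶠ p : ℂ × ℂ in 𝓝 0, AnalyticAt ℂ f (conj p.2) :=
    hconj.eventually (by simpa using hf.eventually_analyticAt)
  have hg2 : ∀ᶠ p : ℂ × ℂ in 𝓝 0, AnalyticAt ℂ g (conj p.2) :=
    hconj.eventually (by simpa using hg.eventually_analyticAt)
  filter_upwards [hfund.eventually_nhds, hF.1.eventually_analyticAt,
    hfst.eventually hf.eventually_analyticAt, hfst.eventually hg.eventually_analyticAt,
    hf2, hg2] with p hp hFp hfp hgp hfp' hgp'
  have hβ : AnalyticAt ℂ (fun w => (1 / 2 : ℂ) * conj (g (conj w))) p.2 :=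
    analyticAt_const.mul hgp'.conj_comp_conj
  have hG : AnalyticAt ℂ (fun q : ℂ × ℂ =>
      (a : ℂ) * F q.1 q.2 + (1 / 2) * g q.1 + (1 / 2) * conj (g (conj q.2))) p :=
    ((analyticAt_const.mul hFp).add
      (analyticAt_const.mul (AnalyticAt.fun_comp (f := Prod.fst) hgp analyticAt_fst))).add
      (AnalyticAt.fun_comp (f := Prod.snd) hβ analyticAt_snd)
  have key := rigidNumerator_substitution (H := F')
    (G := fun z w => (a : ℂ) * F z w + (1 / 2) * g z + (1 / 2) * conj (g (conj w)))
    (ψ := fun w => conj (f (conj w))) hG hfp hfp'.conj_comp_conj (hp.mono fun _ h => h.symm)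
  rw [rigidNumerator_affine (a : ℂ) (α := fun z => (1 / 2) * g z) hFp hβ,
    deriv_conj_comp_conj] at key
  have ha' : (a : ℂ) ^ 2 ≠ 0 := pow_ne_zero 2 (ofReal_ne_zero.mpr ha)
  change rigidNumerator F p.1 p.2 = _ * _ * rigidNumerator F' (f p.1) (conj (f (conj p.2)))
  rw [mul_assoc, ← key, inv_mul_cancel_left₀ ha']
end

section
/- Let F and F' be polarized rigid graphing functions (analytic near the origin of ℂ², holomorphic in each variable, satisfying the reality condition) that are both in prenormal form: F(z,0) ≡ 0, F(0,w) ≡ 0, ∂_w F(z,0) ≡ z, ∂_z F(0,w) ≡ w, and the same for F'. Suppose f, g are holomorphic near 0 ∈ ℂ with f(0) = g(0) = 0 and f'(0) ≠ 0, and ρ ∈ ℝ\{0}, satisfy ρ·F(z,w) + (1/2)g(z) + (1/2)ḡ(w) = F'(f(z), f̄(w)) for all (z,w) near (0,0). Then g ≡ 0 near 0, and there exists λ ∈ ℂ\{0} such that f(z) = λ·z for all z near 0 and ρ = λ·conj(λ); in particular ρ > 0 and f(z) = ρ^{1/2}e^{iφ}z for some φ ∈ ℝ. -/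
open Complex Filter Topology ComplexConjugate

/-- Prenormal form: `F(z,w) = zw + Σ_{j,k ≥ 2} F_{j,k} z^j w^k`. -/
def Prenormal2 (F : ℂ → ℂ → ℂ) : Prop :=
  (∀ᶠ z in 𝓝 (0 : ℂ), F z 0 = 0 ∧ pd2 F z 0 = z) ∧
    (∀ᶠ w in 𝓝 (0 : ℂ), F 0 w = 0 ∧ pd1 F 0 w = w)

/-- Slicing the fundamental equation along `w = 0` kills `g`. -/
theorem eventually_eq_zero_of_fundamental {F F' : ℂ → ℂ → ℂ} {f g : ℂ → ℂ} {ρ : ℂ}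
    (hF : ∀ᶠ z in 𝓝 (0 : ℂ), F z 0 = 0) (hF' : ∀ᶠ z in 𝓝 (0 : ℂ), F' z 0 = 0)
    (hf : ContinuousAt f 0) (hf0 : f 0 = 0) (hg0 : g 0 = 0)
    (hfund : ∀ᶠ p : ℂ × ℂ in 𝓝 0,
      ρ * F p.1 p.2 + (1 / 2) * g p.1 + (1 / 2) * conj (g (conj p.2)) =
        F' (f p.1) (conj (f (conj p.2)))) :
    ∀ᶠ z in 𝓝 (0 : ℂ), g z = 0 := by
  have hslice : Tendsto (fun z : ℂ => (z, (0 : ℂ))) (𝓝 0) (𝓝 0) :=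
    (Continuous.prodMk_left (0 : ℂ)).tendsto' 0 0 rfl
  have hft : Tendsto f (𝓝 0) (𝓝 0) := by simpa [hf0] using hf.tendsto
  filter_upwards [hF, hft.eventually hF', hslice.eventually hfund] with z h1 h2 h3
  simpa [h1, h2, hf0, hg0] using h3

/-- Differentiating the fundamental equation in `w` at `w = 0` linearizes `f`. -/
theorem eventually_mul_conj_deriv_of_fundamental {F F' : ℂ → ℂ → ℂ} {f : ℂ → ℂ} {ρ : ℂ}
    (hF : AnalyticAt ℂ (fun p : ℂ × ℂ => F p.1 p.2) 0)
    (hF' : AnalyticAt ℂ (fun p : ℂ × ℂ => F' p.1 p.2) 0)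
    (hd : ∀ᶠ z in 𝓝 (0 : ℂ), pd2 F z 0 = z) (hd' : ∀ᶠ z in 𝓝 (0 : ℂ), pd2 F' z 0 = z)
    (hf : DifferentiableAt ℂ f 0) (hf0 : f 0 = 0)
    (hfund : ∀ᶠ p : ℂ × ℂ in 𝓝 0, ρ * F p.1 p.2 = F' (f p.1) (conj (f (conj p.2)))) :
    ∀ᶠ z in 𝓝 (0 : ℂ), ρ * z = f z * conj (deriv f 0) := by
  have hslice : Tendsto (fun z : ℂ => (z, (0 : ℂ))) (𝓝 0) (𝓝 0) :=
    (Continuous.prodMk_left (0 : ℂ)).tendsto' 0 0 rfl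
  have hft : Tendsto f (𝓝 0) (𝓝 0) := by simpa [hf0] using hf.continuousAt.tendsto
  have hconj : HasDerivAt (fun w => conj (f (conj w))) (conj (deriv f 0)) 0 := by
    have := hf.hasDerivAt.conj_conj
    simpa [Function.comp_def] using this
  have hsnd : ∀ {G : ℂ → ℂ → ℂ} {z : ℂ}, AnalyticAt ℂ (fun p : ℂ × ℂ => G p.1 p.2) (z, 0) →
      HasDerivAt (G z) (pd2 G z 0) 0 := fun h =>
    h.along_snd.differentiableAt.hasDerivAt
  filter_upwards [hd, hft.eventually hd', hslice.eventually hF.eventually_analyticAt,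
    (hslice.comp hft).eventually hF'.eventually_analyticAt,
    hslice.eventually hfund.eventually_nhds] with z h1 h2 h3 h4 h5
  have hL := (hsnd h3).const_mul ρ
  have hR : HasDerivAt (fun w => F' (f z) (conj (f (conj w))))
      (pd2 F' (f z) 0 * conj (deriv f 0)) 0 :=
    HasDerivAt.comp (h₂ := F' (f z)) 0 (by simpa [hf0] using hsnd h4) hconj
  have hloc : (fun w => ρ * F z w) =ᶠ[𝓝 0] fun w => F' (f z) (conj (f (conj w))) :=
    ((Continuous.prodMk_right z).tendsto (0 : ℂ)).eventually h5
  rw [h1] at hL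
  rw [h2] at hR
  exact hL.unique (hR.congr_of_eventuallyEq hloc)

/-- a rigid biholomorphism between two prenormalized rigid hypersurfaces
in `ℂ²` is a scaling-rotation `z ↦ λz`, `w ↦ ρw` with `ρ = λλ̄ > 0`. -/
theorem stmt5
    (F F' : ℂ → ℂ → ℂ) (hF : IsPolarizedRigid F) (hF' : IsPolarizedRigid F')
    (hpre : Prenormal2 F) (hpre' : Prenormal2 F')
    (f g : ℂ → ℂ) (hf : AnalyticAt ℂ f 0) (hg : AnalyticAt ℂ g 0)
    (hf0 : f 0 = 0) (hg0 : g 0 = 0) (hfd : deriv f 0 ≠ 0)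
    (ρ : ℝ) (hρ : ρ ≠ 0)
    (hfund : ∀ᶠ p : ℂ × ℂ in 𝓝 0,
      (ρ : ℂ) * F p.1 p.2 + (1 / 2) * g p.1 + (1 / 2) * conj (g (conj p.2)) =
        F' (f p.1) (conj (f (conj p.2)))) :
    (∀ᶠ z in 𝓝 (0 : ℂ), g z = 0) ∧
      ∃ lam : ℂ, lam ≠ 0 ∧ (∀ᶠ z in 𝓝 (0 : ℂ), f z = lam * z) ∧
        (ρ : ℂ) = lam * conj lam ∧ 0 < ρ ∧
        ∃ φ : ℝ, ∀ᶠ z in 𝓝 (0 : ℂ),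
          f z = (Real.sqrt ρ : ℂ) * Complex.exp ((φ : ℂ) * Complex.I) * z := by
  have hg' : ∀ᶠ z in 𝓝 (0 : ℂ), g z = 0 :=
    eventually_eq_zero_of_fundamental (hpre.1.mono fun _ h => h.1) (hpre'.1.mono fun _ h => h.1)
      hf.continuousAt hf0 hg0 hfund
  have hconj : Tendsto (fun p : ℂ × ℂ => conj p.2) (𝓝 0) (𝓝 0) :=
    (Complex.continuous_conj.comp continuous_snd).tendsto' 0 0 (by simp)
  have hfund' : ∀ᶠ p : ℂ × ℂ in 𝓝 0,
      (ρ : ℂ) * F p.1 p.2 = F' (f p.1) (conj (f (conj p.2))) := by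
    filter_upwards [hfund, (continuous_fst.tendsto' (0 : ℂ × ℂ) 0 rfl).eventually hg',
      hconj.eventually hg'] with p h h1 h2
    simpa [h1, h2] using h
  have hlin := eventually_mul_conj_deriv_of_fundamental hF.1 hF'.1 (hpre.1.mono fun _ h => h.2)
    (hpre'.1.mono fun _ h => h.2) hf.differentiableAt hf0 hfund'
  have hρl : (ρ : ℂ) = deriv f 0 * conj (deriv f 0) := by
    have h1 := (hasDerivAt_id (0 : ℂ)).const_mul (ρ : ℂ)
    have h2 := hf.differentiableAt.hasDerivAt.mul_const (conj (deriv f 0))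
    simpa using h1.unique (h2.congr_of_eventuallyEq hlin)
  have hfl : ∀ᶠ z in 𝓝 (0 : ℂ), f z = deriv f 0 * z := by
    filter_upwards [hlin] with z h
    have hc : conj (deriv f 0) ≠ 0 := by simpa using hfd
    apply mul_right_cancel₀ hc
    rw [← h, hρl]
    ring
  have hsq : ρ = ‖deriv f 0‖ ^ 2 := by
    rw [Complex.mul_conj, Complex.normSq_eq_norm_sq] at hρl
    exact_mod_cast hρl
  refine ⟨hg', deriv f 0, hfd, hfl, hρl, by rw [hsq]; positivity, arg (deriv f 0), ?_⟩
  rw [hsq, Real.sqrt_sq (norm_nonneg _), Complex.norm_mul_exp_arg_mul_I]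
  exact hfl
end

section
/- The polarized Gaussier–Merker model function m(z, ζ, u, v) := (z·u + (1/2)z²v + (1/2)u²ζ)/(1 − ζv), which is analytic on the open set {(z,ζ,u,v) ∈ ℂ⁴ : ζv ≠ 1}, satisfies: (i) the reality condition m(z,ζ,u,v) = conj(m(conj u, conj v, conj z, conj ζ)); (ii) its Levi determinant vanishes identically: m_{zu}·m_{ζv} − m_{ζu}·m_{zv} ≡ 0 on its domain; (iii) m_{zu}(z,ζ,u,v) = 1/(1 − ζv) is nowhere zero; (iv) the 2-nondegeneracy determinant m_{zu}·m_{zzv} − m_{zv}·m_{zzu} equals 1 at the origin, hence is nonzero there. -/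
open Complex Filter Topology ComplexConjugate

/-- Partial derivative in the first (`z`) slot. -/
noncomputable def pdz (F : ℂ → ℂ → ℂ → ℂ → ℂ) : ℂ → ℂ → ℂ → ℂ → ℂ :=
  fun z ζ u v => deriv (fun t => F t ζ u v) z

/-- Partial derivative in the second (`ζ`) slot. -/
noncomputable def pdc (F : ℂ → ℂ → ℂ → ℂ → ℂ) : ℂ → ℂ → ℂ → ℂ → ℂ :=
  fun z ζ u v => deriv (fun t => F z t u v) ζ

/-- Partial derivative in the third (`u`, i.e. `z̄`) slot. -/
noncomputable def pdu (F : ℂ → ℂ → ℂ → ℂ → ℂ) : ℂ → ℂ → ℂ → ℂ → ℂ :=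
  fun z ζ u v => deriv (fun t => F z ζ t v) u

/-- Partial derivative in the fourth (`v`, i.e. `ζ̄`) slot. -/
noncomputable def pdv (F : ℂ → ℂ → ℂ → ℂ → ℂ) : ℂ → ℂ → ℂ → ℂ → ℂ :=
  fun z ζ u v => deriv (fun t => F z ζ u t) v

/-- Polarized rigid graphing function on `ℂ⁴`: analytic near the origin (hence holomorphic
in each of the four variables) and satisfying the reality condition near the origin. -/
def IsPolarized4 (F : ℂ → ℂ → ℂ → ℂ → ℂ) : Prop :=
  AnalyticAt ℂ (fun p : ℂ × ℂ × ℂ × ℂ => F p.1 p.2.1 p.2.2.1 p.2.2.2) 0 ∧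
    ∀ᶠ p : ℂ × ℂ × ℂ × ℂ in 𝓝 0,
      F p.1 p.2.1 p.2.2.1 p.2.2.2 =
        conj (F (conj p.2.2.1) (conj p.2.2.2) (conj p.1) (conj p.2.1))

/-- The Levi determinant `F_{zu}F_{ζv} − F_{ζu}F_{zv}`. -/
noncomputable def Levi (F : ℂ → ℂ → ℂ → ℂ → ℂ) : ℂ → ℂ → ℂ → ℂ → ℂ :=
  fun z ζ u v =>
    pdz (pdu F) z ζ u v * pdc (pdv F) z ζ u v -
      pdc (pdu F) z ζ u v * pdz (pdv F) z ζ u v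

/-- Taylor coefficient of `z^a ζ^b u^c v^d` in the expansion of `F` at the origin. -/
noncomputable def coeff4 (F : ℂ → ℂ → ℂ → ℂ → ℂ) (a b c d : ℕ) : ℂ :=
  (pdz^[a] (pdc^[b] (pdu^[c] (pdv^[d] F)))) 0 0 0 0 /
    ((a.factorial : ℂ) * (b.factorial : ℂ) * (c.factorial : ℂ) * (d.factorial : ℂ))

/-- Partial derivative in the first slot of a function of two variables. -/
noncomputable def p1 (f : ℂ → ℂ → ℂ) : ℂ → ℂ → ℂ := fun z ζ => deriv (fun t => f t ζ) z

/-- Partial derivative in the second slot of a function of two variables. -/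
noncomputable def p2 (f : ℂ → ℂ → ℂ) : ℂ → ℂ → ℂ := fun z ζ => deriv (fun t => f z t) ζ

/-- Jacobian determinant `f_z g_ζ − f_ζ g_z`. -/
noncomputable def Jac (f g : ℂ → ℂ → ℂ) : ℂ → ℂ → ℂ :=
  fun z ζ => p1 f z ζ * p2 g z ζ - p2 f z ζ * p1 g z ζ

/-- Conjugate function `f̄(u,v) := conj (f (conj u) (conj v))`. -/
noncomputable def bar2 (f : ℂ → ℂ → ℂ) : ℂ → ℂ → ℂ := fun u v => conj (f (conj u) (conj v))

/-- The polarized Gaussier–Merker model. -/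
noncomputable def gm : ℂ → ℂ → ℂ → ℂ → ℂ :=
  fun z ζ u v => (z * u + z ^ 2 * v / 2 + u ^ 2 * ζ / 2) / (1 - ζ * v)

theorem pdu_gm (z ζ u v : ℂ) : pdu gm z ζ u v = (z + u * ζ) / (1 - ζ * v) := by
  have h : HasDerivAt (fun t => (z * t + z ^ 2 * v / 2 + t ^ 2 * ζ / 2) / (1 - ζ * v))
      ((z * 1 + (2 : ℕ) * u ^ (2 - 1) * 1 * ζ / 2) / (1 - ζ * v)) u :=
    (((((hasDerivAt_id' u).const_mul z).add_const _).add
      ((((hasDerivAt_id' u).pow 2).mul_const ζ).div_const 2)).div_const _)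
  refine h.deriv.trans ?_
  congr 1
  norm_num
  ring

theorem pdz_pdu_gm (z ζ u v : ℂ) : pdz (pdu gm) z ζ u v = (1 - ζ * v)⁻¹ := by
  simp only [pdz, pdu_gm]
  exact ((((hasDerivAt_id' z).add_const (u * ζ)).div_const _).deriv).trans (one_div _)

theorem pdz_pdz_pdu_gm (z ζ u v : ℂ) : pdz (pdz (pdu gm)) z ζ u v = 0 := by
  rw [pdz]
  simp only [pdz_pdu_gm, deriv_const]

theorem hasDerivAt_one_sub_mul_left (ζ v : ℂ) : HasDerivAt (fun t => 1 - t * v) (-v) ζ := by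
  simpa using ((hasDerivAt_id' ζ).mul_const v).const_sub 1

theorem hasDerivAt_add_mul (z u ζ : ℂ) : HasDerivAt (fun t => z + u * t) u ζ := by
  simpa using ((hasDerivAt_id' ζ).const_mul u).const_add z

theorem pdc_pdu_gm {z ζ u v : ℂ} (h : ζ * v ≠ 1) :
    pdc (pdu gm) z ζ u v = u / (1 - ζ * v) + (z + u * ζ) * v / (1 - ζ * v) ^ 2 := by
  have hD : 1 - ζ * v ≠ 0 := sub_ne_zero.2 h.symm
  simp only [pdc, pdu_gm]
  refine ((hasDerivAt_add_mul z u ζ).div (hasDerivAt_one_sub_mul_left ζ v) hD).deriv.trans ?_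
  field_simp
  ring

theorem pdv_gm {z ζ u v : ℂ} (h : ζ * v ≠ 1) :
    pdv gm z ζ u v = (z + u * ζ) ^ 2 / 2 / (1 - ζ * v) ^ 2 := by
  have hD : 1 - ζ * v ≠ 0 := sub_ne_zero.2 h.symm
  have hN : HasDerivAt (fun t => z * u + z ^ 2 * t / 2 + u ^ 2 * ζ / 2) (z ^ 2 / 2) v := by
    simpa using ((((hasDerivAt_id' v).const_mul (z ^ 2)).div_const 2).const_add
      (z * u)).add_const (u ^ 2 * ζ / 2)
  have hE : HasDerivAt (fun t => 1 - ζ * t) (-ζ) v := by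
    simpa using ((hasDerivAt_id' v).const_mul ζ).const_sub 1
  refine (hN.div hE hD).deriv.trans ?_
  field_simp
  ring

theorem pdz_pdv_gm {z ζ u v : ℂ} (h : ζ * v ≠ 1) :
    pdz (pdv gm) z ζ u v = (z + u * ζ) / (1 - ζ * v) ^ 2 := by
  simp only [pdz, pdv_gm h]
  refine ((((hasDerivAt_id' z).add_const (u * ζ)).pow 2).div_const 2).div_const _
    |>.deriv.trans ?_
  congr 1
  norm_num

theorem pdz_pdz_pdv_gm {z ζ u v : ℂ} (h : ζ * v ≠ 1) :
    pdz (pdz (pdv gm)) z ζ u v = 1 / (1 - ζ * v) ^ 2 := by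
  rw [pdz]
  simp only [pdz_pdv_gm h]
  exact (((hasDerivAt_id' z).add_const (u * ζ)).div_const _).deriv

theorem pdc_pdv_gm {z ζ u v : ℂ} (h : ζ * v ≠ 1) :
    pdc (pdv gm) z ζ u v =
      (z + u * ζ) * u / (1 - ζ * v) ^ 2 + (z + u * ζ) ^ 2 * v / (1 - ζ * v) ^ 3 := by
  have hD : 1 - ζ * v ≠ 0 := sub_ne_zero.2 h.symm
  have hev : (fun t => pdv gm z t u v) =ᶠ[𝓝 ζ]
      fun t => (z + u * t) ^ 2 / 2 / (1 - t * v) ^ 2 := by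
    have hc : ContinuousAt (fun t : ℂ => t * v) ζ := by fun_prop
    filter_upwards [hc.eventually_ne h] with t ht using pdv_gm ht
  have hd := (((hasDerivAt_add_mul z u ζ).pow 2).div_const 2).div
    ((hasDerivAt_one_sub_mul_left ζ v).pow 2) (pow_ne_zero 2 hD)
  refine hev.deriv_eq.trans (hd.deriv.trans ?_)
  simp only [Pi.pow_apply]
  field_simp
  norm_num
  ring

/-- the polarized Gaussier–Merker model is analytic off `{ζv = 1}`, satisfies
the reality condition, has identically vanishing Levi determinant, has `m_{zu} = 1/(1−ζv)`
nowhere zero, and is 2-nondegenerate at the origin. -/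
theorem stmt8 :
    (∀ p : ℂ × ℂ × ℂ × ℂ, p.2.1 * p.2.2.2 ≠ 1 →
      AnalyticAt ℂ (fun q : ℂ × ℂ × ℂ × ℂ => gm q.1 q.2.1 q.2.2.1 q.2.2.2) p) ∧
    (∀ z ζ u v : ℂ, ζ * v ≠ 1 →
      gm z ζ u v = conj (gm (conj u) (conj v) (conj z) (conj ζ))) ∧
    (∀ z ζ u v : ℂ, ζ * v ≠ 1 → Levi gm z ζ u v = 0) ∧
    (∀ z ζ u v : ℂ, ζ * v ≠ 1 →
      pdz (pdu gm) z ζ u v = (1 - ζ * v)⁻¹ ∧ pdz (pdu gm) z ζ u v ≠ 0) ∧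
    (pdz (pdu gm) 0 0 0 0 * pdz (pdz (pdv gm)) 0 0 0 0 -
        pdz (pdv gm) 0 0 0 0 * pdz (pdz (pdu gm)) 0 0 0 0 = 1) := by
  refine ⟨fun p hp => ?_, fun z ζ u v _ => ?_, fun z ζ u v h => ?_, fun z ζ u v h => ?_, ?_⟩
  · unfold gm
    have hD : 1 - p.2.1 * p.2.2.2 ≠ 0 := sub_ne_zero.2 hp.symm
    have hz : AnalyticAt ℂ (fun q : ℂ × ℂ × ℂ × ℂ => q.1) p := analyticAt_fst
    have hζ : AnalyticAt ℂ (fun q : ℂ × ℂ × ℂ × ℂ => q.2.1) p :=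
      analyticAt_fst.comp analyticAt_snd
    have hu : AnalyticAt ℂ (fun q : ℂ × ℂ × ℂ × ℂ => q.2.2.1) p :=
      analyticAt_fst.comp (analyticAt_snd.comp analyticAt_snd)
    have hv : AnalyticAt ℂ (fun q : ℂ × ℂ × ℂ × ℂ => q.2.2.2) p :=
      analyticAt_snd.comp (analyticAt_snd.comp analyticAt_snd)
    exact (((hz.mul hu).add (((hz.pow 2).mul hv).div analyticAt_const two_ne_zero)).add
      (((hu.pow 2).mul hζ).div analyticAt_const two_ne_zero)).div
      (analyticAt_const.sub (hζ.mul hv)) hD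
  · simp only [gm, map_div₀, map_add, map_sub, map_mul, map_pow, conj_conj, map_one, map_ofNat]
    ring
  · have hD : 1 - ζ * v ≠ 0 := sub_ne_zero.2 h.symm
    rw [Levi, pdz_pdu_gm, pdc_pdv_gm h, pdc_pdu_gm h, pdz_pdv_gm h]
    field_simp
    ring
  · rw [pdz_pdu_gm]
    exact ⟨rfl, inv_ne_zero (sub_ne_zero.2 h.symm)⟩
  · have h : (0 : ℂ) * 0 ≠ 1 := by norm_num
    rw [pdz_pdu_gm, pdz_pdz_pdv_gm h, pdz_pdv_gm h, pdz_pdz_pdu_gm]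
    norm_num
end

section
/- Let F = m + G and F' = m + G' be polarized rigid graphing functions for hypersurfaces in ℂ³ (analytic near 0 ∈ ℂ⁴, holomorphic in each variable, satisfying the reality condition) that are both prenormalized (Taylor coefficients: F_{a,b,0,0} = 0 for all (a,b); F_{a,b,1,0} = 0 for (a,b) ≠ (1,0), F_{1,0,1,0} = 1; F_{a,b,2,0} = 0 for (a,b) ≠ (0,1), F_{0,1,2,0} = 1/2; same for F') and whose Levi determinants vanish identically near 0. Suppose holomorphic f, g, h near 0 ∈ ℂ² with f(0,0) = g(0,0) = h(0,0) = 0 and f_z g_ζ − f_ζ g_z ≠ 0 at 0, together with ρ ∈ ℝ\{0}, satisfy the fundamental equation 2ρF(z,ζ,u,v) + h(z,ζ) + h̄(u,v) = 2F'(f(z,ζ), g(z,ζ), f̄(u,v), ḡ(u,v)) near 0. Then there exist r > 0 and θ ∈ ℝ such that: ρ = r; f(0,ζ) ≡ 0 and ∂_z f(0,ζ) ≡ r^{1/2}e^{iθ} (constant in ζ); g(0,ζ) ≡ e^{2iθ}ζ; and h(0,ζ) ≡ 0, ∂_z h(0,ζ) ≡ 0, ∂_z² h(0,ζ) ≡ 0.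 -/
open Complex Filter Topology ComplexConjugate

/-- Prenormalized Taylor coefficients: `F_{a,b,0,0} = 0`; `F_{a,b,1,0} = 0` except
`F_{1,0,1,0} = 1`; `F_{a,b,2,0} = 0` except `F_{0,1,2,0} = 1/2`. -/
def Prenormal4 (F : ℂ → ℂ → ℂ → ℂ → ℂ) : Prop :=
  (∀ a b : ℕ, coeff4 F a b 0 0 = 0) ∧
    (∀ a b : ℕ, (a, b) ≠ (1, 0) → coeff4 F a b 1 0 = 0) ∧ coeff4 F 1 0 1 0 = 1 ∧
    (∀ a b : ℕ, (a, b) ≠ (0, 1) → coeff4 F a b 2 0 = 0) ∧ coeff4 F 0 1 2 0 = 1 / 2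


/-- A function of four complex variables regarded as a function on `ℂ⁴`. -/
def unc (F : ℂ → ℂ → ℂ → ℂ → ℂ) : ℂ × ℂ × ℂ × ℂ → ℂ := fun p => F p.1 p.2.1 p.2.2.1 p.2.2.2

/-- A function of two complex variables regarded as a function on `ℂ²`. -/
def unc2 (f : ℂ → ℂ → ℂ) : ℂ × ℂ → ℂ := fun q => f q.1 q.2

section FourVariables

variable {F : ℂ → ℂ → ℂ → ℂ → ℂ}

theorem pdz_eq_fderiv {z ζ u v : ℂ} (h : AnalyticAt ℂ (unc F) (z, ζ, u, v)) :
    pdz F z ζ u v = fderiv ℂ (unc F) (z, ζ, u, v) (1, 0, 0, 0) := by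
  have hc : HasDerivAt (fun t : ℂ => (t, ζ, u, v)) (1, 0, 0, 0) z :=
    (hasDerivAt_id z).prodMk (hasDerivAt_const z (ζ, u, v))
  exact (h.differentiableAt.hasFDerivAt.comp_hasDerivAt z hc).deriv

theorem pdc_eq_fderiv {z ζ u v : ℂ} (h : AnalyticAt ℂ (unc F) (z, ζ, u, v)) :
    pdc F z ζ u v = fderiv ℂ (unc F) (z, ζ, u, v) (0, 1, 0, 0) := by
  have hc : HasDerivAt (fun t : ℂ => (z, t, u, v)) (0, 1, 0, 0) ζ :=
    (hasDerivAt_const ζ z).prodMk ((hasDerivAt_id ζ).prodMk (hasDerivAt_const ζ (u, v)))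
  exact (h.differentiableAt.hasFDerivAt.comp_hasDerivAt ζ hc).deriv

theorem pdu_eq_fderiv {z ζ u v : ℂ} (h : AnalyticAt ℂ (unc F) (z, ζ, u, v)) :
    pdu F z ζ u v = fderiv ℂ (unc F) (z, ζ, u, v) (0, 0, 1, 0) := by
  have hc : HasDerivAt (fun t : ℂ => (z, ζ, t, v)) (0, 0, 1, 0) u :=
    (hasDerivAt_const u z).prodMk ((hasDerivAt_const u ζ).prodMk
      ((hasDerivAt_id u).prodMk (hasDerivAt_const u v)))
  exact (h.differentiableAt.hasFDerivAt.comp_hasDerivAt u hc).deriv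

theorem pdv_eq_fderiv {z ζ u v : ℂ} (h : AnalyticAt ℂ (unc F) (z, ζ, u, v)) :
    pdv F z ζ u v = fderiv ℂ (unc F) (z, ζ, u, v) (0, 0, 0, 1) := by
  have hc : HasDerivAt (fun t : ℂ => (z, ζ, u, t)) (0, 0, 0, 1) v :=
    (hasDerivAt_const v z).prodMk ((hasDerivAt_const v ζ).prodMk
      ((hasDerivAt_const v u).prodMk (hasDerivAt_id v)))
  exact (h.differentiableAt.hasFDerivAt.comp_hasDerivAt v hc).deriv

variable {p : ℂ × ℂ × ℂ × ℂ}

theorem unc_pdz_eventuallyEq (h : AnalyticAt ℂ (unc F) p) :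
    unc (pdz F) =ᶠ[𝓝 p] fun q => fderiv ℂ (unc F) q (1, 0, 0, 0) :=
  h.eventually_analyticAt.mono fun _ hq => pdz_eq_fderiv hq

theorem unc_pdc_eventuallyEq (h : AnalyticAt ℂ (unc F) p) :
    unc (pdc F) =ᶠ[𝓝 p] fun q => fderiv ℂ (unc F) q (0, 1, 0, 0) :=
  h.eventually_analyticAt.mono fun _ hq => pdc_eq_fderiv hq

theorem unc_pdu_eventuallyEq (h : AnalyticAt ℂ (unc F) p) :
    unc (pdu F) =ᶠ[𝓝 p] fun q => fderiv ℂ (unc F) q (0, 0, 1, 0) :=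
  h.eventually_analyticAt.mono fun _ hq => pdu_eq_fderiv hq

theorem unc_pdv_eventuallyEq (h : AnalyticAt ℂ (unc F) p) :
    unc (pdv F) =ᶠ[𝓝 p] fun q => fderiv ℂ (unc F) q (0, 0, 0, 1) :=
  h.eventually_analyticAt.mono fun _ hq => pdv_eq_fderiv hq

theorem AnalyticAt.fderiv_apply_const {E : Type*} [NormedAddCommGroup E] [NormedSpace ℂ E]
    {φ : E → ℂ} {x : E} (h : AnalyticAt ℂ φ x) (e : E) :
    AnalyticAt ℂ (fun y => fderiv ℂ φ y e) x :=
  ((ContinuousLinearMap.apply ℂ ℂ e).analyticAt _).comp h.fderiv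

theorem AnalyticAt.unc_pdz (h : AnalyticAt ℂ (unc F) p) : AnalyticAt ℂ (unc (pdz F)) p :=
  (h.fderiv_apply_const _).congr (unc_pdz_eventuallyEq h).symm

theorem AnalyticAt.unc_pdc (h : AnalyticAt ℂ (unc F) p) : AnalyticAt ℂ (unc (pdc F)) p :=
  (h.fderiv_apply_const _).congr (unc_pdc_eventuallyEq h).symm

theorem AnalyticAt.unc_pdu (h : AnalyticAt ℂ (unc F) p) : AnalyticAt ℂ (unc (pdu F)) p :=
  (h.fderiv_apply_const _).congr (unc_pdu_eventuallyEq h).symm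

theorem AnalyticAt.unc_pdv (h : AnalyticAt ℂ (unc F) p) : AnalyticAt ℂ (unc (pdv F)) p :=
  (h.fderiv_apply_const _).congr (unc_pdv_eventuallyEq h).symm

theorem fderiv_fderiv_apply_comm {E : Type*} [NormedAddCommGroup E] [NormedSpace ℂ E]
    {φ : E → ℂ} {x : E} (h : AnalyticAt ℂ φ x) (e e' : E) :
    fderiv ℂ (fun y => fderiv ℂ φ y e) x e' = fderiv ℂ (fun y => fderiv ℂ φ y e') x e := by
  have key (w : E) (w' : E) : fderiv ℂ (fun y => fderiv ℂ φ y w) x w' =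
      fderiv ℂ (fderiv ℂ φ) x w' w := by
    rw [fderiv_clm_apply h.fderiv.differentiableAt (differentiableAt_const w)]
    simp
  rw [key, key]
  exact h.contDiffAt.isSymmSndFDerivAt_of_omega e' e

theorem pdz_pdv_comm {z ζ u v : ℂ} (h : AnalyticAt ℂ (unc F) (z, ζ, u, v)) :
    pdz (pdv F) z ζ u v = pdv (pdz F) z ζ u v := by
  rw [pdz_eq_fderiv h.unc_pdv, pdv_eq_fderiv h.unc_pdz,
    (unc_pdv_eventuallyEq h).fderiv_eq, (unc_pdz_eventuallyEq h).fderiv_eq,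
    fderiv_fderiv_apply_comm h]

theorem pdc_pdu_comm {z ζ u v : ℂ} (h : AnalyticAt ℂ (unc F) (z, ζ, u, v)) :
    pdc (pdu F) z ζ u v = pdu (pdc F) z ζ u v := by
  rw [pdc_eq_fderiv h.unc_pdu, pdu_eq_fderiv h.unc_pdc,
    (unc_pdu_eventuallyEq h).fderiv_eq, (unc_pdc_eventuallyEq h).fderiv_eq,
    fderiv_fderiv_apply_comm h]

theorem pdc_pdv_comm {z ζ u v : ℂ} (h : AnalyticAt ℂ (unc F) (z, ζ, u, v)) :
    pdc (pdv F) z ζ u v = pdv (pdc F) z ζ u v := by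
  rw [pdc_eq_fderiv h.unc_pdv, pdv_eq_fderiv h.unc_pdc,
    (unc_pdv_eventuallyEq h).fderiv_eq, (unc_pdc_eventuallyEq h).fderiv_eq,
    fderiv_fderiv_apply_comm h]

theorem pdu_pdv_comm {z ζ u v : ℂ} (h : AnalyticAt ℂ (unc F) (z, ζ, u, v)) :
    pdu (pdv F) z ζ u v = pdv (pdu F) z ζ u v := by
  rw [pdu_eq_fderiv h.unc_pdv, pdv_eq_fderiv h.unc_pdu,
    (unc_pdv_eventuallyEq h).fderiv_eq, (unc_pdu_eventuallyEq h).fderiv_eq,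
    fderiv_fderiv_apply_comm h]

/-- Chain rule along a curve in `ℂ⁴`. -/
theorem hasDerivAt_comp_four {a b c d : ℂ → ℂ} {a' b' c' d' t : ℂ}
    (h : AnalyticAt ℂ (unc F) (a t, b t, c t, d t))
    (ha : HasDerivAt a a' t) (hb : HasDerivAt b b' t)
    (hc : HasDerivAt c c' t) (hd : HasDerivAt d d' t) :
    HasDerivAt (fun s => F (a s) (b s) (c s) (d s))
      (pdz F (a t) (b t) (c t) (d t) * a' + pdc F (a t) (b t) (c t) (d t) * b' +
        pdu F (a t) (b t) (c t) (d t) * c' + pdv F (a t) (b t) (c t) (d t) * d') t := by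
  have key := h.differentiableAt.hasFDerivAt.comp_hasDerivAt t
    (ha.prodMk (hb.prodMk (hc.prodMk hd)))
  refine key.congr_deriv ?_
  rw [pdz_eq_fderiv h, pdc_eq_fderiv h, pdu_eq_fderiv h, pdv_eq_fderiv h]
  have hdec : ((a', b', c', d') : ℂ × ℂ × ℂ × ℂ) = a' • (1, 0, 0, 0) + b' • (0, 1, 0, 0) +
      c' • (0, 0, 1, 0) + d' • (0, 0, 0, 1) := by
    simp
  rw [hdec]
  simp only [map_add, map_smul, smul_eq_mul]
  ring

theorem eventually_eventually_slice {P : ℂ × ℂ × ℂ × ℂ → Prop} (h : ∀ᶠ p in 𝓝 0, P p) :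
    ∀ᶠ q : ℂ × ℂ in 𝓝 0, ∀ᶠ p in 𝓝 (q.1, q.2, 0, 0), P p := by
  have hc : ContinuousAt (fun q : ℂ × ℂ => (q.1, q.2, (0 : ℂ), (0 : ℂ))) 0 := by fun_prop
  exact hc.eventually (eventually_eventually_nhds.2 h)

theorem eventually_eventually_slice' {P : ℂ × ℂ × ℂ × ℂ → Prop} (h : ∀ᶠ p in 𝓝 0, P p) :
    ∀ᶠ q : ℂ × ℂ in 𝓝 0, ∀ᶠ p in 𝓝 (0, 0, q.1, q.2), P p := by
  have hc : ContinuousAt (fun q : ℂ × ℂ => ((0 : ℂ), (0 : ℂ), q.1, q.2)) 0 := by fun_prop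
  exact hc.eventually (eventually_eventually_nhds.2 h)

end FourVariables

section TwoVariables

variable {φ ψ : ℂ → ℂ → ℂ} {q : ℂ × ℂ}

theorem p2_eq_fderiv {z ζ : ℂ} (h : AnalyticAt ℂ (unc2 φ) (z, ζ)) :
    p2 φ z ζ = fderiv ℂ (unc2 φ) (z, ζ) (0, 1) := by
  have hc : HasDerivAt (fun t : ℂ => (z, t)) (0, 1) ζ :=
    (hasDerivAt_const ζ z).prodMk (hasDerivAt_id ζ)
  exact (h.differentiableAt.hasFDerivAt.comp_hasDerivAt ζ hc).deriv

theorem AnalyticAt.unc2_p2 (h : AnalyticAt ℂ (unc2 φ) q) : AnalyticAt ℂ (unc2 (p2 φ)) q :=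
  (h.fderiv_apply_const (0, 1)).congr
    (h.eventually_analyticAt.mono fun _ hq => (p2_eq_fderiv hq).symm)

theorem eventuallyEq_p1 (h : unc2 φ =ᶠ[𝓝 q] unc2 ψ) : unc2 (p1 φ) =ᶠ[𝓝 q] unc2 (p1 ψ) := by
  filter_upwards [eventually_eventually_nhds.2 h] with x hx
  have hc : ContinuousAt (fun t : ℂ => (t, x.2)) x.1 := by fun_prop
  exact Filter.EventuallyEq.deriv_eq (hc.eventually hx)

theorem eventuallyEq_p2 (h : unc2 φ =ᶠ[𝓝 q] unc2 ψ) : unc2 (p2 φ) =ᶠ[𝓝 q] unc2 (p2 ψ) := by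
  filter_upwards [eventually_eventually_nhds.2 h] with x hx
  have hc : ContinuousAt (fun t : ℂ => (x.1, t)) x.2 := by fun_prop
  exact Filter.EventuallyEq.deriv_eq (hc.eventually hx)

theorem iterate_p1_apply (a : ℕ) (φ : ℂ → ℂ → ℂ) (z ζ : ℂ) :
    (p1^[a] φ) z ζ = (deriv^[a] fun t => φ t ζ) z := by
  induction a generalizing φ with
  | zero => rfl
  | succ n ih => rw [Function.iterate_succ_apply, ih, Function.iterate_succ_apply]; rfl

theorem iterate_p2_apply (b : ℕ) (φ : ℂ → ℂ → ℂ) (z ζ : ℂ) :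
    (p2^[b] φ) z ζ = (deriv^[b] fun t => φ z t) ζ := by
  induction b generalizing φ with
  | zero => rfl
  | succ n ih => rw [Function.iterate_succ_apply, ih, Function.iterate_succ_apply]; rfl

theorem AnalyticOnNhd.iterate_p2 {s : Set (ℂ × ℂ)} (h : AnalyticOnNhd ℂ (unc2 φ) s) (b : ℕ) :
    AnalyticOnNhd ℂ (unc2 (p2^[b] φ)) s := by
  induction b with
  | zero => exact h
  | succ n ih =>
    rw [Function.iterate_succ_apply']
    exact fun x hx => (ih x hx).unc2_p2

theorem AnalyticOnNhd.eqOn_ball_of_iterate_deriv_eq {f g : ℂ → ℂ} {ε : ℝ} (hε : 0 < ε)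
    (hf : AnalyticOnNhd ℂ f (Metric.ball 0 ε)) (hg : AnalyticOnNhd ℂ g (Metric.ball 0 ε))
    (h : ∀ n, (deriv^[n] f) 0 = (deriv^[n] g) 0) : Set.EqOn f g (Metric.ball 0 ε) := by
  have h0 : (0 : ℂ) ∈ Metric.ball (0 : ℂ) ε := Metric.mem_ball_self hε
  refine hf.eqOn_of_preconnected_of_eventuallyEq hg (convex_ball 0 ε).isPreconnected h0 ?_
  have h1 := (hf 0 h0).hasFPowerSeriesAt
  have h2 := (hg 0 h0).hasFPowerSeriesAt
  simp only [iteratedDeriv_eq_iterate, h] at h1 h2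
  filter_upwards [(h1.sub h2).eventually_hasSum_sub] with x hx
  simp only [sub_self] at hx
  exact sub_eq_zero.1 (hx.unique (by simp))

/-- Identity theorem: equal Taylor coefficients at the origin give locally equal functions. -/
theorem eventuallyEq_of_iterate_p1_p2_eq (hφ : AnalyticAt ℂ (unc2 φ) 0)
    (hψ : AnalyticAt ℂ (unc2 ψ) 0)
    (h : ∀ a b, (p1^[a] (p2^[b] φ)) 0 0 = (p1^[a] (p2^[b] ψ)) 0 0) :
    unc2 φ =ᶠ[𝓝 0] unc2 ψ := by
  obtain ⟨ε, hε, hball⟩ := Metric.eventually_nhds_iff_ball.1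
    (hφ.eventually_analyticAt.and hψ.eventually_analyticAt)
  have hmem {z ζ : ℂ} (hz : z ∈ Metric.ball (0 : ℂ) ε) (hζ : ζ ∈ Metric.ball (0 : ℂ) ε) :
      (z, ζ) ∈ Metric.ball (0 : ℂ × ℂ) ε := by
    rw [Prod.zero_eq_mk, ← ball_prod_same]
    exact ⟨hz, hζ⟩
  have hφ' : AnalyticOnNhd ℂ (unc2 φ) (Metric.ball 0 ε) := fun x hx => (hball x hx).1
  have hψ' : AnalyticOnNhd ℂ (unc2 ψ) (Metric.ball 0 ε) := fun x hx => (hball x hx).2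
  have h0 : (0 : ℂ) ∈ Metric.ball (0 : ℂ) ε := Metric.mem_ball_self hε
  have slice1 {χ : ℂ → ℂ → ℂ} (hχ : AnalyticOnNhd ℂ (unc2 χ) (Metric.ball 0 ε)) :
      AnalyticOnNhd ℂ (fun t => χ t 0) (Metric.ball 0 ε) := fun t ht =>
    (hχ _ (hmem ht h0)).comp_of_eq (f := fun t : ℂ => (t, (0 : ℂ)))
      (analyticAt_id.prod analyticAt_const) rfl
  have slice2 {χ : ℂ → ℂ → ℂ} (hχ : AnalyticOnNhd ℂ (unc2 χ) (Metric.ball 0 ε)) {z : ℂ}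
      (hz : z ∈ Metric.ball (0 : ℂ) ε) :
      AnalyticOnNhd ℂ (fun t => χ z t) (Metric.ball 0 ε) := fun t ht =>
    (hχ _ (hmem hz ht)).comp_of_eq (f := fun t : ℂ => (z, t))
      (analyticAt_const.prod analyticAt_id) rfl
  have hcol (b : ℕ) {z : ℂ} (hz : z ∈ Metric.ball (0 : ℂ) ε) :
      (p2^[b] φ) z 0 = (p2^[b] ψ) z 0 :=
    AnalyticOnNhd.eqOn_ball_of_iterate_deriv_eq hε (slice1 (hφ'.iterate_p2 b))
      (slice1 (hψ'.iterate_p2 b)) (fun a => by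
        rw [← iterate_p1_apply, ← iterate_p1_apply, h]) hz
  filter_upwards [Metric.ball_mem_nhds 0 hε] with x hx
  rw [Prod.zero_eq_mk, ← ball_prod_same] at hx
  exact AnalyticOnNhd.eqOn_ball_of_iterate_deriv_eq hε (slice2 hφ' hx.1) (slice2 hψ' hx.1)
    (fun b => by rw [← iterate_p2_apply, ← iterate_p2_apply, hcol b hx.1]) hx.2

theorem eventually_eq_of_p2_eq_zero (hφ : AnalyticAt ℂ (unc2 φ) 0)
    (h : ∀ᶠ q : ℂ × ℂ in 𝓝 0, p2 φ q.1 q.2 = 0) :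
    ∀ᶠ q : ℂ × ℂ in 𝓝 0, φ q.1 q.2 = φ q.1 0 := by
  obtain ⟨ε, hε, hball⟩ := Metric.eventually_nhds_iff_ball.1 (hφ.eventually_analyticAt.and h)
  filter_upwards [Metric.ball_mem_nhds 0 hε] with x hx
  rw [Prod.zero_eq_mk, ← ball_prod_same] at hx hball
  refine Metric.isOpen_ball.is_const_of_deriv_eq_zero (convex_ball (0 : ℂ) ε).isPreconnected
    (f := fun t => φ x.1 t) ?_ (fun t ht => (hball (x.1, t) ⟨hx.1, ht⟩).2) hx.2
    (Metric.mem_ball_self hε)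
  intro t ht
  have hc : HasDerivAt (fun t : ℂ => (x.1, t)) (0, 1) t :=
    (hasDerivAt_const t x.1).prodMk (hasDerivAt_id t)
  exact ((hball (x.1, t) ⟨hx.1, ht⟩).1.differentiableAt.hasFDerivAt.comp_hasDerivAt t
    hc).differentiableAt.differentiableWithinAt

end TwoVariables

section Prenormal

variable {F : ℂ → ℂ → ℂ → ℂ → ℂ}

theorem iterate_p1_slice (a : ℕ) (G : ℂ → ℂ → ℂ → ℂ → ℂ) :
    (p1^[a] fun z ζ => G z ζ 0 0) = fun z ζ => (pdz^[a] G) z ζ 0 0 := by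
  induction a generalizing G with
  | zero => rfl
  | succ n ih => rw [Function.iterate_succ_apply, Function.iterate_succ_apply, ← ih]; rfl

theorem iterate_p2_slice (b : ℕ) (G : ℂ → ℂ → ℂ → ℂ → ℂ) :
    (p2^[b] fun z ζ => G z ζ 0 0) = fun z ζ => (pdc^[b] G) z ζ 0 0 := by
  induction b generalizing G with
  | zero => rfl
  | succ n ih => rw [Function.iterate_succ_apply, Function.iterate_succ_apply, ← ih]; rfl

theorem iterate_p1_p2_slice (a b c : ℕ) :
    (p1^[a] (p2^[b] fun z ζ => (pdu^[c] F) z ζ 0 0)) 0 0 =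
      coeff4 F a b c 0 * (a.factorial * b.factorial * c.factorial) := by
  rw [iterate_p2_slice, iterate_p1_slice, coeff4]
  have ha : (a.factorial : ℂ) ≠ 0 := by exact_mod_cast a.factorial_ne_zero
  have hb : (b.factorial : ℂ) ≠ 0 := by exact_mod_cast b.factorial_ne_zero
  have hc : (c.factorial : ℂ) ≠ 0 := by exact_mod_cast c.factorial_ne_zero
  simp only [Nat.factorial_zero, Nat.cast_one, mul_one, Function.iterate_zero, id_eq]
  field_simp

theorem iterate_p1_p2_const (c : ℂ) (a b : ℕ) (h : (a, b) ≠ (0, 0)) :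
    (p1^[a] (p2^[b] fun _ _ => c)) = fun _ _ => 0 := by
  have h1 (n : ℕ) : (p1^[n] fun _ _ => 0) = fun _ _ => 0 :=
    Function.iterate_fixed (by funext; simp [p1]) n
  have h2 (n : ℕ) : (p2^[n] fun _ _ => 0) = fun _ _ => 0 :=
    Function.iterate_fixed (by funext; simp [p2]) n
  have e1 : (p1 fun _ _ => c) = fun _ _ => 0 := by funext; simp [p1]
  have e2 : (p2 fun _ _ => c) = fun _ _ => 0 := by funext; simp [p2]
  cases b with
  | succ n => rw [Function.iterate_succ_apply, e2, h2, h1]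
  | zero =>
    cases a with
    | succ n => rw [Function.iterate_zero_apply, Function.iterate_succ_apply, e1, h1]
    | zero => exact absurd rfl h

theorem iterate_p1_p2_fst (a b : ℕ) :
    (p1^[a] (p2^[b] fun z _ => z)) 0 0 = if (a, b) = (1, 0) then 1 else 0 := by
  have e1 : (p1 fun z _ => z) = fun _ _ => 1 := by funext; simp [p1]
  have e2 : (p2 fun z _ => z) = fun _ _ => 0 := by funext; simp [p2]
  have h0 (a b : ℕ) : (p1^[a] (p2^[b] fun _ _ => 0)) = fun _ _ => 0 := by
    rcases eq_or_ne (a, b) (0, 0) with h | h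
    · obtain ⟨rfl, rfl⟩ := Prod.mk.inj h; rfl
    · exact iterate_p1_p2_const 0 a b h
  cases b with
  | succ n => rw [Function.iterate_succ_apply, e2, h0]; simp
  | zero =>
    rcases a with _ | _ | n
    · simp
    · simp [e1]
    · rw [Function.iterate_zero_apply, Function.iterate_succ_apply, e1]
      have := iterate_p1_p2_const 1 (n + 1) 0 (by simp)
      rw [Function.iterate_zero_apply] at this
      simp [this]

theorem iterate_p1_p2_snd (a b : ℕ) :
    (p1^[a] (p2^[b] fun _ ζ => ζ)) 0 0 = if (a, b) = (0, 1) then 1 else 0 := by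
  have e1 : (p1 fun _ ζ => ζ) = fun _ _ => 0 := by funext; simp [p1]
  have e2 : (p2 fun _ ζ => ζ) = fun _ _ => 1 := by funext; simp [p2]
  cases b with
  | succ n =>
    rw [Function.iterate_succ_apply, e2]
    rcases eq_or_ne (a, n) (0, 0) with h | h
    · obtain ⟨rfl, rfl⟩ := Prod.mk.inj h; simp
    · rw [iterate_p1_p2_const 1 a n h, if_neg (by simpa using h)]
  | zero =>
    cases a with
    | zero => simp
    | succ n =>
      rw [Function.iterate_zero_apply, Function.iterate_succ_apply, e1,
        Function.iterate_fixed (by funext; simp [p1]) n]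
      simp

theorem AnalyticAt.unc2_slice (h : AnalyticAt ℂ (unc F) 0) :
    AnalyticAt ℂ (unc2 fun z ζ => F z ζ 0 0) 0 :=
  AnalyticAt.comp_of_eq (g := unc F) (f := fun q : ℂ × ℂ => (q.1, q.2, (0 : ℂ), (0 : ℂ))) h
    (analyticAt_fst.prod (analyticAt_snd.prod analyticAt_const)) rfl

theorem Prenormal4.slice_eq_zero (hpre : Prenormal4 F) (hA : AnalyticAt ℂ (unc F) 0) :
    ∀ᶠ q : ℂ × ℂ in 𝓝 0, F q.1 q.2 0 0 = 0 := by
  refine eventuallyEq_of_iterate_p1_p2_eq (ψ := fun _ _ => 0) hA.unc2_slice analyticAt_const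
    fun a b => ?_
  rw [show (fun z ζ => F z ζ 0 0) = fun z ζ => (pdu^[0] F) z ζ 0 0 from rfl,
    iterate_p1_p2_slice, hpre.1]
  rcases eq_or_ne (a, b) (0, 0) with h | h
  · obtain ⟨rfl, rfl⟩ := Prod.mk.inj h; simp
  · simp [iterate_p1_p2_const 0 a b h]

theorem Prenormal4.pdu_slice (hpre : Prenormal4 F) (hA : AnalyticAt ℂ (unc F) 0) :
    ∀ᶠ q : ℂ × ℂ in 𝓝 0, pdu F q.1 q.2 0 0 = q.1 := by
  refine eventuallyEq_of_iterate_p1_p2_eq (φ := fun z ζ => pdu F z ζ 0 0) (ψ := fun z _ => z)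
    hA.unc_pdu.unc2_slice analyticAt_fst fun a b => ?_
  rw [show (fun z ζ => pdu F z ζ 0 0) = fun z ζ => (pdu^[1] F) z ζ 0 0 from rfl,
    iterate_p1_p2_slice, iterate_p1_p2_fst]
  split_ifs with h
  · obtain ⟨rfl, rfl⟩ := Prod.mk.inj h; simp [hpre.2.2.1]
  · simp [hpre.2.1 a b h]

theorem Prenormal4.pdu_pdu_slice (hpre : Prenormal4 F) (hA : AnalyticAt ℂ (unc F) 0) :
    ∀ᶠ q : ℂ × ℂ in 𝓝 0, pdu (pdu F) q.1 q.2 0 0 = q.2 := by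
  refine eventuallyEq_of_iterate_p1_p2_eq (φ := fun z ζ => pdu (pdu F) z ζ 0 0)
    (ψ := fun _ ζ => ζ) hA.unc_pdu.unc_pdu.unc2_slice analyticAt_snd fun a b => ?_
  rw [show (fun z ζ => pdu (pdu F) z ζ 0 0) = fun z ζ => (pdu^[2] F) z ζ 0 0 from rfl,
    iterate_p1_p2_slice, iterate_p1_p2_snd]
  split_ifs with h
  · obtain ⟨rfl, rfl⟩ := Prod.mk.inj h; simp [hpre.2.2.2.2]
  · simp [hpre.2.2.2.1 a b h]

theorem IsPolarized4.slice_eq_zero (hF : IsPolarized4 F) (hpre : Prenormal4 F) :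
    ∀ᶠ q : ℂ × ℂ in 𝓝 0, F 0 0 q.1 q.2 = 0 := by
  have hc : ContinuousAt (fun q : ℂ × ℂ => (conj q.1, conj q.2)) 0 := by fun_prop
  have hz := (hpre.slice_eq_zero hF.1)
  rw [show (0 : ℂ × ℂ) = (conj (0 : ℂ × ℂ).1, conj (0 : ℂ × ℂ).2) from
    Prod.ext (by simp) (by simp)] at hz
  filter_upwards [eventually_eventually_slice' hF.2, hc.eventually hz] with q hq hq'
  simpa [hq'] using hq.self_of_nhds

theorem IsPolarized4.pdz_slice (hF : IsPolarized4 F) (hpre : Prenormal4 F) :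
    ∀ᶠ q : ℂ × ℂ in 𝓝 0, pdz F 0 0 q.1 q.2 = q.1 := by
  have hc : ContinuousAt (fun q : ℂ × ℂ => (conj q.1, conj q.2)) 0 := by fun_prop
  have hz := (hpre.pdu_slice hF.1)
  rw [show (0 : ℂ × ℂ) = (conj (0 : ℂ × ℂ).1, conj (0 : ℂ × ℂ).2) from
    Prod.ext (by simp) (by simp)] at hz
  filter_upwards [eventually_eventually_slice' hF.2, hc.eventually hz] with q hq hq'
  have hc' : ContinuousAt (fun t : ℂ => (t, (0 : ℂ), q.1, q.2)) 0 := by fun_prop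
  have key : (fun t => F t 0 q.1 q.2) =ᶠ[𝓝 0]
      conj ∘ (fun t => F (conj q.1) (conj q.2) t 0) ∘ conj := by
    filter_upwards [hc'.eventually hq] with t ht
    simpa using ht
  have h2 : pdz F 0 0 q.1 q.2 = deriv (fun t => F t 0 q.1 q.2) 0 := rfl
  rw [h2, key.deriv_eq, deriv_conj_conj]
  have h3 : deriv (fun t => F (conj q.1) (conj q.2) t 0) 0 = conj q.1 := hq'
  simp [h3]

theorem pdv_zero_eq_zero (hF : IsPolarized4 F) (hpre : Prenormal4 F) : pdv F 0 0 0 0 = 0 := by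
  have h : unc2 (fun u v => F 0 0 u v) =ᶠ[𝓝 0] unc2 fun _ _ => 0 := hF.slice_eq_zero hpre
  exact (eventuallyEq_p2 h).self_of_nhds.trans (by simp [unc2, p2])

theorem pdu_pdv_zero_eq_zero (hF : IsPolarized4 F) (hpre : Prenormal4 F) :
    pdu (pdv F) 0 0 0 0 = 0 := by
  have h : unc2 (fun u v => F 0 0 u v) =ᶠ[𝓝 0] unc2 fun _ _ => 0 := hF.slice_eq_zero hpre
  exact (eventuallyEq_p1 (eventuallyEq_p2 h)).self_of_nhds.trans (by simp [unc2, p1, p2])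

theorem pdv_pdv_zero_eq_zero (hF : IsPolarized4 F) (hpre : Prenormal4 F) :
    pdv (pdv F) 0 0 0 0 = 0 := by
  have h : unc2 (fun u v => F 0 0 u v) =ᶠ[𝓝 0] unc2 fun _ _ => 0 := hF.slice_eq_zero hpre
  exact (eventuallyEq_p2 (eventuallyEq_p2 h)).self_of_nhds.trans (by simp [unc2, p2])

theorem pdz_pdv_zero_eq_zero (hF : IsPolarized4 F) (hpre : Prenormal4 F) :
    pdz (pdv F) 0 0 0 0 = 0 := by
  have h : unc2 (fun u v => pdz F 0 0 u v) =ᶠ[𝓝 0] unc2 fun u _ => u := hF.pdz_slice hpre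
  rw [pdz_pdv_comm hF.1]
  exact (eventuallyEq_p2 h).self_of_nhds.trans (by simp [unc2, p2])

theorem pdz_pdu_slice (hF : IsPolarized4 F) (hpre : Prenormal4 F) :
    ∀ᶠ q : ℂ × ℂ in 𝓝 0, pdz (pdu F) q.1 q.2 0 0 = 1 := by
  have h : unc2 (fun z ζ => pdu F z ζ 0 0) =ᶠ[𝓝 0] unc2 fun z _ => z := hpre.pdu_slice hF.1
  exact (eventuallyEq_p1 h).mono fun q hq => hq.trans (by simp [unc2, p1])

theorem pdc_pdu_slice (hF : IsPolarized4 F) (hpre : Prenormal4 F) :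
    ∀ᶠ q : ℂ × ℂ in 𝓝 0, pdc (pdu F) q.1 q.2 0 0 = 0 := by
  have h : unc2 (fun z ζ => pdu F z ζ 0 0) =ᶠ[𝓝 0] unc2 fun z _ => z := hpre.pdu_slice hF.1
  exact (eventuallyEq_p2 h).mono fun q hq => hq.trans (by simp [unc2, p2])

end Prenormal

section LeviFlat

variable {F : ℂ → ℂ → ℂ → ℂ → ℂ}

theorem pdc_pdv_slice (hF : IsPolarized4 F) (hpre : Prenormal4 F)
    (hLevi : ∀ᶠ p : ℂ × ℂ × ℂ × ℂ in 𝓝 0, Levi F p.1 p.2.1 p.2.2.1 p.2.2.2 = 0) :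
    ∀ᶠ q : ℂ × ℂ in 𝓝 0, pdc (pdv F) q.1 q.2 0 0 = 0 := by
  filter_upwards [pdz_pdu_slice hF hpre, pdc_pdu_slice hF hpre,
    eventually_eventually_slice hLevi] with q h1 h2 h3
  simpa [Levi, h1, h2] using h3.self_of_nhds

theorem pdv_slice (hF : IsPolarized4 F) (hpre : Prenormal4 F)
    (hLevi : ∀ᶠ p : ℂ × ℂ × ℂ × ℂ in 𝓝 0, Levi F p.1 p.2.1 p.2.2.1 p.2.2.2 = 0) :
    ∀ᶠ q : ℂ × ℂ in 𝓝 0, pdv F q.1 q.2 0 0 = pdv F q.1 0 0 0 := by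
  have hA : AnalyticAt ℂ (unc F) 0 := hF.1
  exact eventually_eq_of_p2_eq_zero (φ := fun z ζ => pdv F z ζ 0 0) hA.unc_pdv.unc2_slice
    (pdc_pdv_slice hF hpre hLevi)

theorem tendsto_zero_prod : Tendsto (fun ζ : ℂ => ((0 : ℂ), ζ)) (𝓝 0) (𝓝 0) :=
  Continuous.tendsto' (by fun_prop) _ _ rfl

theorem pdv_axis (hF : IsPolarized4 F) (hpre : Prenormal4 F)
    (hLevi : ∀ᶠ p : ℂ × ℂ × ℂ × ℂ in 𝓝 0, Levi F p.1 p.2.1 p.2.2.1 p.2.2.2 = 0) :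
    ∀ᶠ ζ in 𝓝 (0 : ℂ), pdv F 0 ζ 0 0 = 0 :=
  (tendsto_zero_prod.eventually (pdv_slice hF hpre hLevi)).mono fun _ hζ =>
    hζ.trans (pdv_zero_eq_zero hF hpre)

theorem pdz_pdv_axis (hF : IsPolarized4 F) (hpre : Prenormal4 F)
    (hLevi : ∀ᶠ p : ℂ × ℂ × ℂ × ℂ in 𝓝 0, Levi F p.1 p.2.1 p.2.2.1 p.2.2.2 = 0) :
    ∀ᶠ ζ in 𝓝 (0 : ℂ), pdz (pdv F) 0 ζ 0 0 = 0 := by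
  have h : unc2 (fun z ζ => pdv F z ζ 0 0) =ᶠ[𝓝 0] unc2 fun z _ => pdv F z 0 0 0 :=
    pdv_slice hF hpre hLevi
  exact (tendsto_zero_prod.eventually (eventuallyEq_p1 h)).mono fun ζ hζ =>
    hζ.trans (pdz_pdv_zero_eq_zero hF hpre)

theorem hasDerivAt_pdu {z ζ u v : ℂ} (h : AnalyticAt ℂ (unc F) (z, ζ, u, v)) :
    HasDerivAt (fun t => F z ζ t v) (pdu F z ζ u v) u := by
  simpa using hasDerivAt_comp_four (t := u) h (hasDerivAt_const u z) (hasDerivAt_const u ζ)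
    (hasDerivAt_id' u) (hasDerivAt_const u v)

theorem hasDerivAt_pdv {z ζ u v : ℂ} (h : AnalyticAt ℂ (unc F) (z, ζ, u, v)) :
    HasDerivAt (fun t => F z ζ u t) (pdv F z ζ u v) v := by
  simpa using hasDerivAt_comp_four (t := v) h (hasDerivAt_const v z) (hasDerivAt_const v ζ)
    (hasDerivAt_const v u) (hasDerivAt_id' v)

theorem eventually_analyticAt_axis {φ : ℂ × ℂ × ℂ × ℂ → ℂ} (h : AnalyticAt ℂ φ 0) :
    ∀ᶠ ζ in 𝓝 (0 : ℂ), AnalyticAt ℂ φ (0, ζ, 0, 0) :=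
  (tendsto_zero_prod.eventually (eventually_eventually_slice h.eventually_analyticAt)).mono
    fun _ hζ => hζ.self_of_nhds

theorem pdu_pdc_pdv_axis (hF : IsPolarized4 F) (hpre : Prenormal4 F)
    (hLevi : ∀ᶠ p : ℂ × ℂ × ℂ × ℂ in 𝓝 0, Levi F p.1 p.2.1 p.2.2.1 p.2.2.2 = 0) :
    ∀ᶠ ζ in 𝓝 (0 : ℂ), pdu (pdc (pdv F)) 0 ζ 0 0 = 0 := by
  filter_upwards [eventually_analyticAt_axis (φ := unc F) hF.1,
    tendsto_zero_prod.eventually (pdz_pdu_slice hF hpre),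
    tendsto_zero_prod.eventually (pdc_pdu_slice hF hpre),
    tendsto_zero_prod.eventually (pdc_pdv_slice hF hpre hLevi),
    pdz_pdv_axis hF hpre hLevi,
    tendsto_zero_prod.eventually (eventually_eventually_slice hLevi)] with ζ hA hP hR hQ hS hL
  have hc : ContinuousAt (fun t : ℂ => ((0 : ℂ), ζ, t, (0 : ℂ))) 0 := by fun_prop
  have hd := ((hasDerivAt_pdu hA.unc_pdu.unc_pdz).mul (hasDerivAt_pdu hA.unc_pdv.unc_pdc)).sub
    ((hasDerivAt_pdu hA.unc_pdu.unc_pdc).mul (hasDerivAt_pdu hA.unc_pdv.unc_pdz))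
  have h0 := (hasDerivAt_const (0 : ℂ) (0 : ℂ)).congr_of_eventuallyEq (hc.eventually hL)
  have h := hd.unique h0
  simpa [hP, hR, hQ, hS] using h

theorem pdv_pdc_pdv_axis (hF : IsPolarized4 F) (hpre : Prenormal4 F)
    (hLevi : ∀ᶠ p : ℂ × ℂ × ℂ × ℂ in 𝓝 0, Levi F p.1 p.2.1 p.2.2.1 p.2.2.2 = 0) :
    ∀ᶠ ζ in 𝓝 (0 : ℂ), pdv (pdc (pdv F)) 0 ζ 0 0 = 0 := by
  filter_upwards [eventually_analyticAt_axis (φ := unc F) hF.1,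
    tendsto_zero_prod.eventually (pdz_pdu_slice hF hpre),
    tendsto_zero_prod.eventually (pdc_pdu_slice hF hpre),
    tendsto_zero_prod.eventually (pdc_pdv_slice hF hpre hLevi),
    pdz_pdv_axis hF hpre hLevi,
    tendsto_zero_prod.eventually (eventually_eventually_slice hLevi)] with ζ hA hP hR hQ hS hL
  have hc : ContinuousAt (fun t : ℂ => ((0 : ℂ), ζ, (0 : ℂ), t)) 0 := by fun_prop
  have hd := ((hasDerivAt_pdv hA.unc_pdu.unc_pdz).mul (hasDerivAt_pdv hA.unc_pdv.unc_pdc)).sub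
    ((hasDerivAt_pdv hA.unc_pdu.unc_pdc).mul (hasDerivAt_pdv hA.unc_pdv.unc_pdz))
  have h0 := (hasDerivAt_const (0 : ℂ) (0 : ℂ)).congr_of_eventuallyEq (hc.eventually hL)
  have h := hd.unique h0
  simpa [hP, hR, hQ, hS] using h

theorem axis_eq_zero_of_pdc {G : ℂ → ℂ → ℂ → ℂ → ℂ} (hG : AnalyticAt ℂ (unc G) 0)
    (h0 : G 0 0 0 0 = 0) (h : ∀ᶠ ζ in 𝓝 (0 : ℂ), pdc G 0 ζ 0 0 = 0) :
    ∀ᶠ ζ in 𝓝 (0 : ℂ), G 0 ζ 0 0 = 0 := by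
  have hφ : AnalyticAt ℂ (unc2 fun _ ζ => G 0 ζ 0 0) 0 :=
    AnalyticAt.comp_of_eq (g := unc G) (f := fun q : ℂ × ℂ => ((0 : ℂ), q.2, (0 : ℂ), (0 : ℂ)))
      hG (analyticAt_const.prod (analyticAt_snd.prod analyticAt_const)) rfl
  have hs : Tendsto (fun q : ℂ × ℂ => q.2) (𝓝 0) (𝓝 0) := Continuous.tendsto' (by fun_prop) _ _ rfl
  have key := eventually_eq_of_p2_eq_zero hφ (hs.eventually h)
  exact (tendsto_zero_prod.eventually key).mono fun ζ hζ => hζ.trans h0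

theorem pdu_pdv_axis (hF : IsPolarized4 F) (hpre : Prenormal4 F)
    (hLevi : ∀ᶠ p : ℂ × ℂ × ℂ × ℂ in 𝓝 0, Levi F p.1 p.2.1 p.2.2.1 p.2.2.2 = 0) :
    ∀ᶠ ζ in 𝓝 (0 : ℂ), pdu (pdv F) 0 ζ 0 0 = 0 := by
  have hA : AnalyticAt ℂ (unc F) 0 := hF.1
  refine axis_eq_zero_of_pdc hA.unc_pdv.unc_pdu (pdu_pdv_zero_eq_zero hF hpre) ?_
  filter_upwards [eventually_analyticAt_axis hA, pdu_pdc_pdv_axis hF hpre hLevi] with ζ h1 h2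
  rw [pdc_pdu_comm h1.unc_pdv, h2]

theorem pdv_pdv_axis (hF : IsPolarized4 F) (hpre : Prenormal4 F)
    (hLevi : ∀ᶠ p : ℂ × ℂ × ℂ × ℂ in 𝓝 0, Levi F p.1 p.2.1 p.2.2.1 p.2.2.2 = 0) :
    ∀ᶠ ζ in 𝓝 (0 : ℂ), pdv (pdv F) 0 ζ 0 0 = 0 := by
  have hA : AnalyticAt ℂ (unc F) 0 := hF.1
  refine axis_eq_zero_of_pdc hA.unc_pdv.unc_pdv (pdv_pdv_zero_eq_zero hF hpre) ?_
  filter_upwards [eventually_analyticAt_axis hA, pdv_pdc_pdv_axis hF hpre hLevi] with ζ h1 h2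
  rw [pdc_pdv_comm h1.unc_pdv, h2]

theorem hasDerivAt_comp_last_two {a b : ℂ → ℂ} {a' b' t : ℂ} (z ζ : ℂ)
    (h : AnalyticAt ℂ (unc F) (z, ζ, a t, b t)) (ha : HasDerivAt a a' t)
    (hb : HasDerivAt b b' t) :
    HasDerivAt (fun s => F z ζ (a s) (b s))
      (pdu F z ζ (a t) (b t) * a' + pdv F z ζ (a t) (b t) * b') t := by
  simpa using hasDerivAt_comp_four h (hasDerivAt_const t z) (hasDerivAt_const t ζ) ha hb

end LeviFlat

theorem AnalyticAt.conj_conj {φ : ℂ → ℂ} (h : AnalyticAt ℂ φ 0) :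
    AnalyticAt ℂ (conj ∘ φ ∘ conj) 0 := by
  rw [Complex.analyticAt_iff_eventually_differentiableAt] at h ⊢
  have hc : Tendsto (fun z : ℂ => conj z) (𝓝 0) (𝓝 0) :=
    Continuous.tendsto' (by fun_prop) _ _ (by simp)
  exact (hc.eventually h).mono fun x hx => by simpa using hx.conj_conj

theorem AnalyticAt.unc2_fst {f : ℂ → ℂ → ℂ} (h : AnalyticAt ℂ (unc2 f) 0) :
    AnalyticAt ℂ (fun t => f t 0) 0 :=
  AnalyticAt.comp_of_eq (g := unc2 f) (f := fun t : ℂ => (t, (0 : ℂ))) h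
    (analyticAt_id.prod analyticAt_const) rfl

theorem bar2_fst_eq (f : ℂ → ℂ → ℂ) :
    (fun t => bar2 f t 0) = conj ∘ (fun t => f t 0) ∘ conj := by
  funext t; simp [bar2]

theorem AnalyticAt.bar2_fst {f : ℂ → ℂ → ℂ} (h : AnalyticAt ℂ (unc2 f) 0) :
    AnalyticAt ℂ (fun t => bar2 f t 0) 0 := by
  rw [bar2_fst_eq]; exact h.unc2_fst.conj_conj

theorem deriv_bar2_fst (f : ℂ → ℂ → ℂ) :
    deriv (fun t => bar2 f t 0) 0 = conj (p1 f 0 0) := by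
  rw [bar2_fst_eq, deriv_conj_conj]; simp [p1]

section FundamentalEquation

variable {F F' : ℂ → ℂ → ℂ → ℂ → ℂ} {f g h : ℂ → ℂ → ℂ} {ρ : ℝ}

theorem tendsto_map_prod (hf : AnalyticAt ℂ (unc2 f) 0) (hg : AnalyticAt ℂ (unc2 g) 0)
    (hf0 : f 0 0 = 0) (hg0 : g 0 0 = 0) :
    Tendsto (fun q : ℂ × ℂ => (f q.1 q.2, g q.1 q.2)) (𝓝 0) (𝓝 0) := by
  have := (hf.continuousAt.prodMk hg.continuousAt).tendsto
  have e : (unc2 f 0, unc2 g 0) = (0 : ℂ × ℂ) := Prod.ext hf0 hg0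
  rwa [e] at this

theorem eventually_pluriharmonic_part_eq_zero (hF : IsPolarized4 F) (hF' : IsPolarized4 F')
    (hpre : Prenormal4 F) (hpre' : Prenormal4 F')
    (hf : AnalyticAt ℂ (unc2 f) 0) (hg : AnalyticAt ℂ (unc2 g) 0)
    (hf0 : f 0 0 = 0) (hg0 : g 0 0 = 0) (hh0 : h 0 0 = 0)
    (hfund : ∀ᶠ p : ℂ × ℂ × ℂ × ℂ in 𝓝 0,
      2 * (ρ : ℂ) * F p.1 p.2.1 p.2.2.1 p.2.2.2 + h p.1 p.2.1 + bar2 h p.2.2.1 p.2.2.2 =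
        2 * F' (f p.1 p.2.1) (g p.1 p.2.1) (bar2 f p.2.2.1 p.2.2.2) (bar2 g p.2.2.1 p.2.2.2)) :
    ∀ᶠ q : ℂ × ℂ in 𝓝 0, h q.1 q.2 = 0 := by
  filter_upwards [eventually_eventually_slice hfund, hpre.slice_eq_zero hF.1,
    (tendsto_map_prod hf hg hf0 hg0).eventually (hpre'.slice_eq_zero hF'.1)] with q h1 h2 h3
  simpa [bar2, hf0, hg0, hh0, h2, h3] using h1.self_of_nhds

theorem fundamental_eq_of_h_eq_zero (hh : ∀ᶠ q : ℂ × ℂ in 𝓝 0, h q.1 q.2 = 0)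
    (hfund : ∀ᶠ p : ℂ × ℂ × ℂ × ℂ in 𝓝 0,
      2 * (ρ : ℂ) * F p.1 p.2.1 p.2.2.1 p.2.2.2 + h p.1 p.2.1 + bar2 h p.2.2.1 p.2.2.2 =
        2 * F' (f p.1 p.2.1) (g p.1 p.2.1) (bar2 f p.2.2.1 p.2.2.2) (bar2 g p.2.2.1 p.2.2.2)) :
    ∀ᶠ p : ℂ × ℂ × ℂ × ℂ in 𝓝 0, (ρ : ℂ) * F p.1 p.2.1 p.2.2.1 p.2.2.2 =
      F' (f p.1 p.2.1) (g p.1 p.2.1) (bar2 f p.2.2.1 p.2.2.2) (bar2 g p.2.2.1 p.2.2.2) := by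
  have t1 : Tendsto (fun p : ℂ × ℂ × ℂ × ℂ => (p.1, p.2.1)) (𝓝 0) (𝓝 0) :=
    Continuous.tendsto' (by fun_prop) _ _ rfl
  have t2 : Tendsto (fun p : ℂ × ℂ × ℂ × ℂ => (conj p.2.2.1, conj p.2.2.2)) (𝓝 0) (𝓝 0) :=
    Continuous.tendsto' (by fun_prop) _ _ (Prod.ext (by simp) (by simp))
  filter_upwards [hfund, t1.eventually hh, t2.eventually hh] with p h1 h2 h3
  have h3' : bar2 h p.2.2.1 p.2.2.2 = 0 := by rw [bar2, h3, map_zero]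
  rw [h2, h3'] at h1
  linear_combination h1 / 2

/-- First-order part in `u` of the fundamental equation along `u = v = 0`. -/
theorem fundamental_first_order (hF : IsPolarized4 F) (hF' : IsPolarized4 F')
    (hpre : Prenormal4 F) (hpre' : Prenormal4 F')
    (hLevi' : ∀ᶠ p : ℂ × ℂ × ℂ × ℂ in 𝓝 0, Levi F' p.1 p.2.1 p.2.2.1 p.2.2.2 = 0)
    (hf : AnalyticAt ℂ (unc2 f) 0) (hg : AnalyticAt ℂ (unc2 g) 0)
    (hf0 : f 0 0 = 0) (hg0 : g 0 0 = 0)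
    (hred : ∀ᶠ p : ℂ × ℂ × ℂ × ℂ in 𝓝 0, (ρ : ℂ) * F p.1 p.2.1 p.2.2.1 p.2.2.2 =
      F' (f p.1 p.2.1) (g p.1 p.2.1) (bar2 f p.2.2.1 p.2.2.2) (bar2 g p.2.2.1 p.2.2.2)) :
    ∀ᶠ q : ℂ × ℂ in 𝓝 0, (ρ : ℂ) * q.1 =
      f q.1 q.2 * conj (p1 f 0 0) + pdv F' (f q.1 q.2) 0 0 0 * conj (p1 g 0 0) := by
  have hA : AnalyticAt ℂ (unc F) 0 := hF.1
  have hA' : AnalyticAt ℂ (unc F') 0 := hF'.1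
  have ht := tendsto_map_prod hf hg hf0 hg0
  have ha0 : bar2 f 0 0 = 0 := by simp [bar2, hf0]
  have hb0 : bar2 g 0 0 = 0 := by simp [bar2, hg0]
  have ha := hf.bar2_fst.differentiableAt.hasDerivAt
  have hb := hg.bar2_fst.differentiableAt.hasDerivAt
  rw [deriv_bar2_fst] at ha hb
  filter_upwards [eventually_eventually_slice hred,
    eventually_eventually_slice hA.eventually_analyticAt,
    ht.eventually (eventually_eventually_slice hA'.eventually_analyticAt),
    hpre.pdu_slice hF.1, ht.eventually (hpre'.pdu_slice hF'.1),
    ht.eventually (pdv_slice hF' hpre' hLevi')] with q h1 h2 h3 h4 h5 h6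
  have hc : ContinuousAt (fun t : ℂ => (q.1, q.2, t, (0 : ℂ))) 0 := by fun_prop
  have hl := (hasDerivAt_pdu h2.self_of_nhds).const_mul (ρ : ℂ)
  have hr := hasDerivAt_comp_last_two (F := F') (t := 0) (f q.1 q.2) (g q.1 q.2)
    (by simpa only [ha0, hb0] using h3.self_of_nhds) ha hb
  have := hl.unique (hr.congr_of_eventuallyEq (hc.eventually h1))
  simpa only [ha0, hb0, h4, h5, h6] using this

theorem f_axis_eq_zero (hF : IsPolarized4 F) (hF' : IsPolarized4 F')
    (hpre : Prenormal4 F) (hpre' : Prenormal4 F')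
    (hLevi' : ∀ᶠ p : ℂ × ℂ × ℂ × ℂ in 𝓝 0, Levi F' p.1 p.2.1 p.2.2.1 p.2.2.2 = 0)
    (hf : AnalyticAt ℂ (unc2 f) 0) (hg : AnalyticAt ℂ (unc2 g) 0)
    (hf0 : f 0 0 = 0) (hg0 : g 0 0 = 0)
    (hred : ∀ᶠ p : ℂ × ℂ × ℂ × ℂ in 𝓝 0, (ρ : ℂ) * F p.1 p.2.1 p.2.2.1 p.2.2.2 =
      F' (f p.1 p.2.1) (g p.1 p.2.1) (bar2 f p.2.2.1 p.2.2.2) (bar2 g p.2.2.1 p.2.2.2))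
    (hα : conj (p1 f 0 0) ≠ 0) :
    ∀ᶠ ζ in 𝓝 (0 : ℂ), f 0 ζ = 0 := by
  have hA' : AnalyticAt ℂ (unc F') 0 := hF'.1
  have hB : HasDerivAt (fun w => pdv F' w 0 0 0) 0 0 := by
    have := hasDerivAt_comp_four (t := 0) hA'.unc_pdv (hasDerivAt_id' (0 : ℂ))
      (hasDerivAt_const 0 0) (hasDerivAt_const 0 0) (hasDerivAt_const 0 0)
    simpa [pdz_pdv_zero_eq_zero hF' hpre'] using this
  have hψ := ((hasDerivAt_id' (0 : ℂ)).mul_const (conj (p1 f 0 0))).add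
    (hB.mul_const (conj (p1 g 0 0)))
  have hne := hψ.eventually_ne (c := 0) (by simpa using hα)
  rw [eventually_nhdsWithin_iff] at hne
  have htf : Tendsto (unc2 f) (𝓝 0) (𝓝 0) := by
    simpa only [show unc2 f 0 = 0 from hf0] using hf.continuousAt.tendsto
  filter_upwards [(htf.comp tendsto_zero_prod).eventually hne, tendsto_zero_prod.eventually
    (fundamental_first_order hF hF' hpre hpre' hLevi' hf hg hf0 hg0 hred)] with ζ h1 h2
  by_contra hcon
  exact h1 hcon (by simpa [unc2] using h2.symm)

theorem rho_eq_conj_mul_p1 (hF : IsPolarized4 F) (hF' : IsPolarized4 F')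
    (hpre : Prenormal4 F) (hpre' : Prenormal4 F')
    (hLevi' : ∀ᶠ p : ℂ × ℂ × ℂ × ℂ in 𝓝 0, Levi F' p.1 p.2.1 p.2.2.1 p.2.2.2 = 0)
    (hf : AnalyticAt ℂ (unc2 f) 0) (hg : AnalyticAt ℂ (unc2 g) 0)
    (hf0 : f 0 0 = 0) (hg0 : g 0 0 = 0)
    (hred : ∀ᶠ p : ℂ × ℂ × ℂ × ℂ in 𝓝 0, (ρ : ℂ) * F p.1 p.2.1 p.2.2.1 p.2.2.2 =
      F' (f p.1 p.2.1) (g p.1 p.2.1) (bar2 f p.2.2.1 p.2.2.2) (bar2 g p.2.2.1 p.2.2.2)) :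
    ∀ᶠ ζ in 𝓝 (0 : ℂ), f 0 ζ = 0 → (ρ : ℂ) = conj (p1 f 0 0) * p1 f 0 ζ := by
  have hA' : AnalyticAt ℂ (unc F') 0 := hF'.1
  filter_upwards [tendsto_zero_prod.eventually (eventually_eventually_nhds.2
    (fundamental_first_order hF hF' hpre hpre' hLevi' hf hg hf0 hg0 hred)),
    tendsto_zero_prod.eventually hf.eventually_analyticAt] with ζ h1 h2 hζ
  have hc : ContinuousAt (fun t : ℂ => (t, ζ)) 0 := by fun_prop
  have hfd : HasDerivAt (fun t => f t ζ) (p1 f 0 ζ) 0 :=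
    (h2.comp_of_eq (f := fun t : ℂ => (t, ζ)) (analyticAt_id.prod analyticAt_const)
      rfl).differentiableAt.hasDerivAt
  have hB := hasDerivAt_comp_four (F := pdv F') (t := 0) (a := fun t => f t ζ)
    (by simp only [hζ]; exact hA'.unc_pdv) hfd
    (hasDerivAt_const 0 0) (hasDerivAt_const 0 0) (hasDerivAt_const 0 0)
  have hr := (hfd.mul_const (conj (p1 f 0 0))).add (hB.mul_const (conj (p1 g 0 0)))
  have hl := (hasDerivAt_id' (0 : ℂ)).const_mul (ρ : ℂ)
  have := hl.unique (hr.congr_of_eventuallyEq (hc.eventually h1))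
  simpa [hζ, pdz_pdv_zero_eq_zero hF' hpre', mul_comm] using this

theorem g_axis (hF : IsPolarized4 F) (hF' : IsPolarized4 F')
    (hpre : Prenormal4 F) (hpre' : Prenormal4 F')
    (hLevi' : ∀ᶠ p : ℂ × ℂ × ℂ × ℂ in 𝓝 0, Levi F' p.1 p.2.1 p.2.2.1 p.2.2.2 = 0)
    (hf : AnalyticAt ℂ (unc2 f) 0) (hg : AnalyticAt ℂ (unc2 g) 0)
    (hf0 : f 0 0 = 0) (hg0 : g 0 0 = 0)
    (hred : ∀ᶠ p : ℂ × ℂ × ℂ × ℂ in 𝓝 0, (ρ : ℂ) * F p.1 p.2.1 p.2.2.1 p.2.2.2 =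
      F' (f p.1 p.2.1) (g p.1 p.2.1) (bar2 f p.2.2.1 p.2.2.2) (bar2 g p.2.2.1 p.2.2.2))
    (hfax : ∀ᶠ ζ in 𝓝 (0 : ℂ), f 0 ζ = 0) :
    ∀ᶠ ζ in 𝓝 (0 : ℂ), (ρ : ℂ) * ζ = g 0 ζ * conj (p1 f 0 0) ^ 2 := by
  have hA : AnalyticAt ℂ (unc F) 0 := hF.1
  have hA' : AnalyticAt ℂ (unc F') 0 := hF'.1
  have ha0 : bar2 f 0 0 = 0 := by simp [bar2, hf0]
  have hb0 : bar2 g 0 0 = 0 := by simp [bar2, hg0]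
  have ha := hf.bar2_fst
  have hb := hg.bar2_fst
  have htg : Tendsto (fun ζ => g 0 ζ) (𝓝 0) (𝓝 0) := by
    have htg' : Tendsto (unc2 g) (𝓝 0) (𝓝 0) := by
      simpa only [show unc2 g 0 = 0 from hg0] using hg.continuousAt.tendsto
    exact htg'.comp tendsto_zero_prod
  filter_upwards [hfax, tendsto_zero_prod.eventually (eventually_eventually_slice hred),
    eventually_analyticAt_axis hA, htg.eventually (eventually_analyticAt_axis hA'),
    tendsto_zero_prod.eventually (hpre.pdu_pdu_slice hF.1),
    htg.eventually (tendsto_zero_prod.eventually (hpre'.pdu_slice hF'.1)),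
    htg.eventually (tendsto_zero_prod.eventually (hpre'.pdu_pdu_slice hF'.1)),
    htg.eventually (pdv_axis hF' hpre' hLevi'),
    htg.eventually (pdu_pdv_axis hF' hpre' hLevi'),
    htg.eventually (pdv_pdv_axis hF' hpre' hLevi')]
    with ζ hfζ hr hAζ hAg hFuu hFu' hFuu' hFv' hFuv' hFvv'
  have hc : ContinuousAt (fun t : ℂ => ((0 : ℂ), ζ, t, (0 : ℂ))) 0 := by fun_prop
  have hc' : Tendsto (fun t : ℂ => ((0 : ℂ), g 0 ζ, bar2 f t 0, bar2 g t 0)) (𝓝 0)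
      (𝓝 (0, g 0 ζ, 0, 0)) := by
    have := (continuousAt_const (y := (0 : ℂ))).tendsto.prodMk_nhds
      ((continuousAt_const (y := g 0 ζ)).tendsto.prodMk_nhds
        (ha.continuousAt.tendsto.prodMk_nhds hb.continuousAt.tendsto))
    simpa only [ha0, hb0] using this
  have hfirst : (fun t => (ρ : ℂ) * pdu F 0 ζ t 0) =ᶠ[𝓝 0] fun t =>
      pdu F' 0 (g 0 ζ) (bar2 f t 0) (bar2 g t 0) * deriv (fun t => bar2 f t 0) t +
        pdv F' 0 (g 0 ζ) (bar2 f t 0) (bar2 g t 0) * deriv (fun t => bar2 g t 0) t := by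
    filter_upwards [eventually_eventually_nhds.2 (hc.eventually hr),
      hc.eventually hAζ.eventually_analyticAt, hc'.eventually hAg.eventually_analyticAt,
      ha.eventually_analyticAt, hb.eventually_analyticAt] with t h1 h2 h3 h4 h5
    have hl := (hasDerivAt_pdu h2).const_mul (ρ : ℂ)
    have hr := hasDerivAt_comp_last_two (F := F') (t := t) 0 (g 0 ζ) h3
      h4.differentiableAt.hasDerivAt h5.differentiableAt.hasDerivAt
    refine hl.unique (hr.congr_of_eventuallyEq (h1.mono fun s hs => ?_))
    simpa only [hfζ] using hs
  have hAg' : AnalyticAt ℂ (unc F') (0, g 0 ζ, bar2 f 0 0, bar2 g 0 0) := by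
    simpa only [ha0, hb0] using hAg
  have hda := ha.differentiableAt.hasDerivAt
  have hdb := hb.differentiableAt.hasDerivAt
  have hl := (hasDerivAt_pdu hAζ.unc_pdu).const_mul (ρ : ℂ)
  have hr := ((hasDerivAt_comp_last_two (a := fun t => bar2 f t 0) (b := fun t => bar2 g t 0)
      0 (g 0 ζ) hAg'.unc_pdu hda hdb).mul
      ha.deriv.differentiableAt.hasDerivAt).add
    ((hasDerivAt_comp_last_two (a := fun t => bar2 f t 0) (b := fun t => bar2 g t 0)
      0 (g 0 ζ) hAg'.unc_pdv hda hdb).mul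
      hb.deriv.differentiableAt.hasDerivAt)
  have key := hl.unique (hr.congr_of_eventuallyEq hfirst)
  have hFvu' : pdv (pdu F') 0 (g 0 ζ) 0 0 = 0 := by rw [← pdu_pdv_comm hAg, hFuv']
  simp only [ha0, hb0, hFuu, hFu', hFuu', hFv', hFuv', hFvv', hFvu', deriv_bar2_fst] at key
  linear_combination key

end FundamentalEquation

/-- a rigid biholomorphism between two prenormalized hypersurfaces
`{u = m + G}` and `{u' = m + G'}` is, modulo the dilation-rotation isotropy of the
Gaussier–Merker model, tangent to the identity: `f = r^{1/2}e^{iθ}z + O(weight 2)`,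
`g = e^{2iθ}ζ + O(weight 1)`, `h = O(weight 3)`, `ρ = r`. -/
theorem stmt11
    (F F' : ℂ → ℂ → ℂ → ℂ → ℂ) (hF : IsPolarized4 F) (hF' : IsPolarized4 F')
    (hpre : Prenormal4 F) (hpre' : Prenormal4 F')
    (hLevi : ∀ᶠ p : ℂ × ℂ × ℂ × ℂ in 𝓝 0, Levi F p.1 p.2.1 p.2.2.1 p.2.2.2 = 0)
    (hLevi' : ∀ᶠ p : ℂ × ℂ × ℂ × ℂ in 𝓝 0, Levi F' p.1 p.2.1 p.2.2.1 p.2.2.2 = 0)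
    (f g h : ℂ → ℂ → ℂ)
    (hf : AnalyticAt ℂ (fun q : ℂ × ℂ => f q.1 q.2) 0)
    (hg : AnalyticAt ℂ (fun q : ℂ × ℂ => g q.1 q.2) 0)
    (hh : AnalyticAt ℂ (fun q : ℂ × ℂ => h q.1 q.2) 0)
    (hf0 : f 0 0 = 0) (hg0 : g 0 0 = 0) (hh0 : h 0 0 = 0)
    (hJ : Jac f g 0 0 ≠ 0)
    (ρ : ℝ) (hρ : ρ ≠ 0)
    (hfund : ∀ᶠ p : ℂ × ℂ × ℂ × ℂ in 𝓝 0,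
      2 * (ρ : ℂ) * F p.1 p.2.1 p.2.2.1 p.2.2.2 + h p.1 p.2.1 +
          bar2 h p.2.2.1 p.2.2.2 =
        2 * F' (f p.1 p.2.1) (g p.1 p.2.1)
            (bar2 f p.2.2.1 p.2.2.2) (bar2 g p.2.2.1 p.2.2.2)) :
    ∃ r : ℝ, 0 < r ∧ ∃ θ : ℝ, ρ = r ∧
      ∀ᶠ ζ in 𝓝 (0 : ℂ),
        f 0 ζ = 0 ∧
        p1 f 0 ζ = ((Real.sqrt r : ℝ) : ℂ) * Complex.exp ((θ : ℂ) * Complex.I) ∧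
        g 0 ζ = Complex.exp (2 * (θ : ℂ) * Complex.I) * ζ ∧
        h 0 ζ = 0 ∧ p1 h 0 ζ = 0 ∧ p1 (p1 h) 0 ζ = 0 := by
  have hh' : ∀ᶠ q : ℂ × ℂ in 𝓝 0, h q.1 q.2 = 0 :=
    eventually_pluriharmonic_part_eq_zero hF hF' hpre hpre' hf hg hf0 hg0 hh0 hfund
  have hred := fundamental_eq_of_h_eq_zero hh' hfund
  have hα0 : conj (p1 f 0 0) ≠ 0 := fun h0 => hρ <| by
    simpa [h0, hf0] using
      (rho_eq_conj_mul_p1 hF hF' hpre hpre' hLevi' hf hg hf0 hg0 hred).self_of_nhds hf0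
  have hfax := f_axis_eq_zero hF hF' hpre hpre' hLevi' hf hg hf0 hg0 hred hα0
  have hρα := rho_eq_conj_mul_p1 hF hF' hpre hpre' hLevi' hf hg hf0 hg0 hred
  have hgax := g_axis hF hF' hpre hpre' hLevi' hf hg hf0 hg0 hred hfax
  set α := p1 f 0 0 with hα
  have hρ0 : (ρ : ℂ) = conj α * α := hρα.self_of_nhds hf0
  have hρn : ρ = ‖α‖ ^ 2 := by
    rw [Complex.conj_mul'] at hρ0
    exact_mod_cast hρ0
  have hpos : 0 < ρ := lt_of_le_of_ne (hρn ▸ sq_nonneg _) hρ.symm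
  have hpolar : ((Real.sqrt ρ : ℝ) : ℂ) * Complex.exp ((α.arg : ℂ) * Complex.I) = α := by
    rw [hρn, Real.sqrt_sq (norm_nonneg α), Complex.norm_mul_exp_arg_mul_I]
  have hexp : Complex.exp (2 * (α.arg : ℂ) * Complex.I) * conj α = α := by
    generalize α.arg = θ at hpolar ⊢
    rw [← hpolar, map_mul, Complex.conj_ofReal, ← Complex.exp_conj, map_mul, Complex.conj_ofReal,
      Complex.conj_I, mul_left_comm, ← Complex.exp_add]
    congr 2
    ring
  refine ⟨ρ, hpos, α.arg, rfl, ?_⟩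
  have hp1h : unc2 (p1 h) =ᶠ[𝓝 0] unc2 (p1 fun _ _ => 0) := eventuallyEq_p1 hh'
  filter_upwards [hfax, hρα, hgax, tendsto_zero_prod.eventually hh',
    tendsto_zero_prod.eventually hp1h,
    tendsto_zero_prod.eventually (eventuallyEq_p1 hp1h)] with ζ h1 h2 h3 h4 h5 h6
  refine ⟨h1, ?_, ?_, h4, h5.trans (by simp [unc2, p1]), h6.trans (by simp [unc2, p1])⟩
  · rw [hpolar]
    exact mul_left_cancel₀ hα0 ((h2 h1).symm.trans hρ0)
  · refine mul_right_cancel₀ (pow_ne_zero 2 hα0) ?_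
    rw [← h3, hρ0]
    linear_combination (-(conj α * ζ)) * hexp
end
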